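/- Let P ⊆ ℝ² be a simple polygon region with vertices v₁, …, vₙ such that [vₙ, v₁] is an edge of P, P is contained in one of the two closed half-planes bounded by the line through vₙ and v₁, and P is weakly visible from the edge [vₙ, v₁], i.e., every point of P is seen in P from some point of [vₙ, v₁]. Let G be a finite set of points of the frontier of P that guards the frontier of P. Then there exists a set G' ⊆ {v₁, …, vₙ} of vertices with |G'| ≤ |G| such that G ∪ G' guards all of P, i.e., every point of P is seen in P from some point of G ∪ G'. -/

import Mathlib

/-- `P` is a simple polygon region with the `n` vertices `v 0, …, v (n-1)`:
a compact subset of the plane with nonempty interior, equal to the closure of its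
interior, whose frontier is the union of the `n` edges `[v i, v (i+1)]` (indices
mod `n`), such that consecutive edges meet exactly in their common vertex and
non-consecutive edges are disjoint. -/
def IsSimplePolygonRegion {n : ℕ} [NeZero n]
    (P : Set (EuclideanSpace ℝ (Fin 2))) (v : Fin n → EuclideanSpace ℝ (Fin 2)) : Prop :=
  3 ≤ n ∧ Function.Injective v ∧ IsCompact P ∧ (interior P).Nonempty ∧
  P = closure (interior P) ∧
  frontier P = ⋃ i : Fin n, segment ℝ (v i) (v (i + 1)) ∧
  (∀ i : Fin n, segment ℝ (v i) (v (i + 1)) ∩ segment ℝ (v (i + 1)) (v (i + 1 + 1))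
      = {v (i + 1)}) ∧
  (∀ i j : Fin n, i ≠ j → j ≠ i + 1 → i ≠ j + 1 →
    Disjoint (segment ℝ (v i) (v (i + 1))) (segment ℝ (v j) (v (j + 1))))


namespace WV

/-- orientation determinant -/
def cr (A B C : ℝ × ℝ) : ℝ := (B.1 - A.1) * (C.2 - A.2) - (B.2 - A.2) * (C.1 - A.1)

lemma mem_seg {A B q : ℝ × ℝ} : q ∈ segment ℝ A B ↔
    ∃ t : ℝ, 0 ≤ t ∧ t ≤ 1 ∧ q.1 = A.1 + t * (B.1 - A.1) ∧ q.2 = A.2 + t * (B.2 - A.2) := by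
  rw [segment_eq_image]
  constructor
  · rintro ⟨t, ⟨h0, h1⟩, rfl⟩
    refine ⟨t, h0, h1, ?_, ?_⟩ <;> simp <;> ring
  · rintro ⟨t, h0, h1, ha, hb⟩
    refine ⟨t, ⟨h0, h1⟩, ?_⟩
    ext
    · simp [ha]; ring
    · simp [hb]; ring

lemma mem_seg_cr {A B q : ℝ × ℝ} (h : q ∈ segment ℝ A B) : cr A B q = 0 := by
  obtain ⟨t, -, -, ha, hb⟩ := mem_seg.1 h
  simp only [cr, ha, hb]; ring

/-- local structure of the frontier -/
def Loc (P N : Set (ℝ × ℝ)) (x : ℝ × ℝ) : Prop :=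
  ∃ ε > 0, ∃ d1 d2 : ℝ × ℝ, d1 ≠ 0 ∧ d2 ≠ 0 ∧
    (∀ q ∈ Metric.ball x ε, q ∈ frontier P ↔ ∃ t : ℝ, 0 ≤ t ∧ (q = x + t • d1 ∨ q = x + t • d2)) ∧
    (∀ t : ℝ, 0 < t → d2 ≠ t • d1) ∧ (x ∉ N → d2 = - d1)

structure Core (P N : Set (ℝ × ℝ)) (u w : ℝ) : Prop where
  huw : u < w
  cpt : IsCompact P
  reg : P = closure (interior P)
  conn : IsPreconnected (frontier P)
  loc : ∀ x ∈ frontier P, Loc P N x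
  half : ∀ p ∈ P, 0 ≤ p.2
  edge : segment ℝ ((u, 0) : ℝ × ℝ) (w, 0) ⊆ frontier P
  uN : ((u, 0) : ℝ × ℝ) ∈ N
  wv : ∀ p ∈ P, ∃ t, u ≤ t ∧ t ≤ w ∧ segment ℝ ((t, 0) : ℝ × ℝ) p ⊆ P

lemma dichot {P S : Set (ℝ × ℝ)} (hS : IsPreconnected S) (h : ∀ q ∈ S, q ∉ frontier P) :
    S ⊆ P ∨ S ⊆ Pᶜ := by
  by_contra hcon
  push Not at hcon
  obtain ⟨h1, h2⟩ := hcon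
  rw [Set.not_subset] at h1 h2
  obtain ⟨a, ha, haP⟩ := h1
  obtain ⟨b, hb, hbP⟩ := h2
  simp at hbP
  have key : ∀ q ∈ S, q ∈ interior P ∨ q ∉ closure P := by
    intro q hq
    by_contra hc
    push Not at hc
    exact h q hq ⟨hc.2, hc.1⟩
  obtain ⟨q, hq, hq1, hq2⟩ := hS (interior P) (closure P)ᶜ isOpen_interior
    isClosed_closure.isOpen_compl (fun q hq => key q hq)
    ⟨b, hb, (key b hb).resolve_right (fun h => h (subset_closure hbP))⟩
    ⟨a, ha, (key a ha).resolve_left (fun h => haP (interior_subset h))⟩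
  exact hq2 (subset_closure (interior_subset hq1))

lemma small_mem (x d : ℝ × ℝ) {ε : ℝ} (hε : 0 < ε) : ∃ s : ℝ, 0 < s ∧ x + s • d ∈ Metric.ball x ε := by
  refine ⟨ε / (2 * (‖d‖ + 1)), by positivity, ?_⟩
  rw [Metric.mem_ball, dist_eq_norm]
  have h1 : x + (ε / (2 * (‖d‖ + 1))) • d - x = (ε / (2 * (‖d‖ + 1))) • d := by abel
  rw [h1, norm_smul, Real.norm_of_nonneg (by positivity), div_mul_eq_mul_div, div_lt_iff₀ (by positivity)]
  nlinarith [norm_nonneg d]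

lemma convex_pos (a b c : ℝ) : Convex ℝ {q : ℝ × ℝ | 0 < a * q.1 + b * q.2 + c} := by
  intro x hx y hy s t hs ht hst
  simp only [Set.mem_ofPred_eq, Prod.fst_add, Prod.snd_add, Prod.smul_fst, Prod.smul_snd, smul_eq_mul] at *
  have : a * (s * x.1 + t * y.1) + b * (s * x.2 + t * y.2) + c
    = s * (a * x.1 + b * x.2 + c) + t * (a * y.1 + b * y.2 + c) := by
    linear_combination (-c) * hst
  rw [this]
  rcases eq_or_lt_of_le hs with h | h
  · have : t = 1 := by linarith
    rw [← h, this]; simpa using hy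
  · have := mul_pos h hx
    have := mul_nonneg ht hy.le
    linarith

lemma convex_neg (a b c : ℝ) : Convex ℝ {q : ℝ × ℝ | a * q.1 + b * q.2 + c < 0} := by
  have := convex_pos (-a) (-b) (-c)
  have e : {q : ℝ × ℝ | a * q.1 + b * q.2 + c < 0} = {q : ℝ × ℝ | 0 < -a * q.1 + -b * q.2 + -c} := by
    ext q
    simp only [Set.mem_ofPred_eq]
    constructor <;> intro h <;> linarith
  rw [e]; exact this

def TwoSides (P : Set (ℝ × ℝ)) (x : ℝ × ℝ) (ε : ℝ) : Prop :=
  ∃ S1 S2 : Set (ℝ × ℝ), IsPreconnected S1 ∧ IsPreconnected S2 ∧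
      (∀ q ∈ S1 ∪ S2, q ∈ Metric.ball x ε ∧ q ∉ frontier P) ∧
      (∀ q ∈ Metric.ball x ε, q ∉ frontier P → q ∈ S1 ∪ S2)

lemma two_sides_pos {P : Set (ℝ × ℝ)} {x : ℝ × ℝ} {ε : ℝ} (hε : 0 < ε) {d1 d2 : ℝ × ℝ}
    (hf : ∀ q ∈ Metric.ball x ε, q ∈ frontier P ↔ ∃ t : ℝ, 0 ≤ t ∧ (q = x + t • d1 ∨ q = x + t • d2))
    (hpos : 0 < d1.1 * d2.2 - d1.2 * d2.1) : TwoSides P x ε := by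
  set Δ := d1.1 * d2.2 - d1.2 * d2.1 with hΔ
  let D1 : ℝ × ℝ → ℝ := fun q => d1.1 * (q.2 - x.2) - d1.2 * (q.1 - x.1)
  let D2 : ℝ × ℝ → ℝ := fun q => (q.1 - x.1) * d2.2 - (q.2 - x.2) * d2.1
  have c1 : Convex ℝ {q | 0 < D1 q} := by
    convert convex_pos (-d1.2) d1.1 (d1.2 * x.1 - d1.1 * x.2) using 4
    simp only [D1]; ring
  have c2 : Convex ℝ {q | 0 < D2 q} := by
    convert convex_pos (d2.2) (-d2.1) (d2.1 * x.2 - d2.2 * x.1) using 4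
    simp only [D2]; ring
  have c1' : Convex ℝ {q | D1 q < 0} := by
    convert convex_neg (-d1.2) d1.1 (d1.2 * x.1 - d1.1 * x.2) using 4
    simp only [D1]; ring
  have c2' : Convex ℝ {q | D2 q < 0} := by
    convert convex_neg (d2.2) (-d2.1) (d2.1 * x.2 - d2.2 * x.1) using 4
    simp only [D2]; ring
  have cb := convex_ball x ε
  refine ⟨Metric.ball x ε ∩ ({q | 0 < D1 q} ∩ {q | 0 < D2 q}),
    (Metric.ball x ε ∩ {q | D1 q < 0}) ∪ (Metric.ball x ε ∩ {q | D2 q < 0}),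
    (cb.inter (c1.inter c2)).isPreconnected, ?_, ?_, ?_⟩
  · apply IsPreconnected.union' _ (cb.inter c1').isPreconnected (cb.inter c2').isPreconnected
    obtain ⟨s, hs, hm⟩ := small_mem x (-(d1 + d2)) hε
    refine ⟨_, ⟨hm, ?_⟩, ⟨hm, ?_⟩⟩
    · simp only [D1, Set.mem_ofPred_eq, Prod.fst_add, Prod.snd_add, Prod.smul_fst, Prod.smul_snd,
        Prod.fst_neg, Prod.snd_neg, smul_eq_mul]
      nlinarith [mul_pos hs hpos]
    · simp only [D2, Set.mem_ofPred_eq, Prod.fst_add, Prod.snd_add, Prod.smul_fst, Prod.smul_snd,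
        Prod.fst_neg, Prod.snd_neg, smul_eq_mul]
      nlinarith [mul_pos hs hpos]
  · intro q hq
    have hqb : q ∈ Metric.ball x ε := by
      rcases hq with h | h | h
      exacts [h.1, h.1, h.1]
    refine ⟨hqb, ?_⟩
    intro hqf
    obtain ⟨t, ht, h⟩ := (hf q hqb).1 hqf
    have hq' : (0 < D1 q ∧ 0 < D2 q) ∨ D1 q < 0 ∨ D2 q < 0 := by
      rcases hq with h | h | h
      exacts [Or.inl h.2, Or.inr (Or.inl h.2), Or.inr (Or.inr h.2)]
    have hm := mul_nonneg ht hpos.le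
    rcases h with rfl | rfl
    · have e1 : D1 (x + t • d1) = 0 := by simp [D1]; ring
      have e2 : D2 (x + t • d1) = t * Δ := by simp [D2, Δ]; ring
      rw [e1, e2] at hq'
      rcases hq' with h | h | h
      · exact lt_irrefl _ h.1
      · exact lt_irrefl _ h
      · linarith
    · have e1 : D1 (x + t • d2) = t * Δ := by simp [D1, Δ]; ring
      have e2 : D2 (x + t • d2) = 0 := by simp [D2]; ring
      rw [e1, e2] at hq'
      rcases hq' with h | h | h
      · exact lt_irrefl _ h.2
      · linarith
      · exact lt_irrefl _ h
  · intro q hqb hqf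
    by_contra hcon
    have h0 : ¬ (0 < D1 q ∧ 0 < D2 q) := fun h => hcon (Or.inl ⟨hqb, h⟩)
    have h1 : 0 ≤ D1 q := by
      by_contra h; push Not at h
      exact hcon (Or.inr (Or.inl ⟨hqb, h⟩))
    have h2 : 0 ≤ D2 q := by
      by_contra h; push Not at h
      exact hcon (Or.inr (Or.inr ⟨hqb, h⟩))
    have i1 : Δ * (q.1 - x.1) = D2 q * d1.1 + D1 q * d2.1 := by simp only [D1, D2, Δ]; ring
    have i2 : Δ * (q.2 - x.2) = D2 q * d1.2 + D1 q * d2.2 := by simp only [D1, D2, Δ]; ring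
    apply hqf
    rw [hf q hqb]
    rcases eq_or_lt_of_le h1 with h | h
    · refine ⟨D2 q / Δ, by positivity, Or.inl ?_⟩
      rw [← h] at i1 i2
      ext
      · simp; field_simp; linarith
      · simp; field_simp; linarith
    · have h' : D2 q = 0 := by
        by_contra hne
        exact h0 ⟨h, lt_of_le_of_ne h2 (Ne.symm hne)⟩
      refine ⟨D1 q / Δ, by positivity, Or.inr ?_⟩
      rw [h'] at i1 i2
      ext
      · simp; field_simp; linarith
      · simp; field_simp; linarith

lemma two_sides_opp {P : Set (ℝ × ℝ)} {x : ℝ × ℝ} {ε : ℝ} {d1 d2 : ℝ × ℝ} (h1 : d1 ≠ 0)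
    (hf : ∀ q ∈ Metric.ball x ε, q ∈ frontier P ↔ ∃ t : ℝ, 0 ≤ t ∧ (q = x + t • d1 ∨ q = x + t • d2))
    {c : ℝ} (hc : c < 0) (h2 : d2 = c • d1) : TwoSides P x ε := by
  let D1 : ℝ × ℝ → ℝ := fun q => d1.1 * (q.2 - x.2) - d1.2 * (q.1 - x.1)
  have c1 : Convex ℝ {q | 0 < D1 q} := by
    convert convex_pos (-d1.2) d1.1 (d1.2 * x.1 - d1.1 * x.2) using 4
    simp only [D1]; ring
  have c1' : Convex ℝ {q | D1 q < 0} := by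
    convert convex_neg (-d1.2) d1.1 (d1.2 * x.1 - d1.1 * x.2) using 4
    simp only [D1]; ring
  have cb := convex_ball x ε
  refine ⟨_, _, (cb.inter c1).isPreconnected, (cb.inter c1').isPreconnected, ?_, ?_⟩
  · intro q hq
    have hqb : q ∈ Metric.ball x ε := by
      rcases hq with h | h
      exacts [h.1, h.1]
    refine ⟨hqb, fun hqf => ?_⟩
    have hne : D1 q ≠ 0 := by
      rcases hq with h | h
      exacts [ne_of_gt h.2, ne_of_lt h.2]
    obtain ⟨t, ht, h⟩ := (hf q hqb).1 hqf
    apply hne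
    rcases h with rfl | rfl
    · simp [D1]; ring
    · simp [D1, h2]; ring
  · intro q hqb hqf
    by_contra hcon
    have e : D1 q = 0 := by
      by_contra hne
      rcases lt_or_gt_of_ne hne with h | h
      · exact hcon (Or.inr ⟨hqb, h⟩)
      · exact hcon (Or.inl ⟨hqb, h⟩)
    have hs : ∃ s : ℝ, q = x + s • d1 := by
      simp only [D1] at e
      by_cases hd : d1.1 = 0
      · have hd2 : d1.2 ≠ 0 := fun h => h1 (Prod.ext hd h)
        refine ⟨(q.2 - x.2) / d1.2, ?_⟩
        have : q.1 = x.1 := by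
          rw [hd] at e
          have : d1.2 * (q.1 - x.1) = 0 := by linarith
          rcases mul_eq_zero.1 this with h | h
          · exact absurd h hd2
          · linarith
        ext
        · simp [hd, this]
        · simp; field_simp; ring
      · refine ⟨(q.1 - x.1) / d1.1, ?_⟩
        ext
        · simp; field_simp; ring
        · simp; field_simp; linarith
    obtain ⟨s, hs⟩ := hs
    apply hqf
    rw [hf q hqb]
    by_cases h : 0 ≤ s
    · exact ⟨s, h, Or.inl hs⟩
    · push Not at h
      refine ⟨s / c, (div_pos_of_neg_of_neg h hc).le, Or.inr ?_⟩
      rw [hs, h2, smul_smul, div_mul_cancel₀ _ hc.ne]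

lemma Loc.two_sides {P N : Set (ℝ × ℝ)} {x : ℝ × ℝ} (h : Loc P N x) : ∃ ε > 0, TwoSides P x ε := by
  obtain ⟨ε, hε, d1, d2, h1, h2, hf, hnp, -⟩ := h
  refine ⟨ε, hε, ?_⟩
  rcases lt_trichotomy (d1.1 * d2.2 - d1.2 * d2.1) 0 with h | h | h
  · apply two_sides_pos hε (d1 := d2) (d2 := d1) _ (by linarith)
    intro q hq
    rw [hf q hq]
    simp only [or_comm]
  · have : ∃ c : ℝ, d2 = c • d1 := by
      by_cases hd : d1.1 = 0
      · have hd2 : d1.2 ≠ 0 := fun h => h1 (Prod.ext hd h)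
        refine ⟨d2.2 / d1.2, ?_⟩
        have : d2.1 = 0 := by
          rw [hd] at h
          have : d1.2 * d2.1 = 0 := by linarith
          exact (mul_eq_zero.1 this).resolve_left hd2
        ext
        · simp [hd, this]
        · simp; field_simp
      · refine ⟨d2.1 / d1.1, ?_⟩
        ext
        · simp; field_simp
        · simp; field_simp; linarith
    obtain ⟨c, hc⟩ := this
    have hc0 : c < 0 := by
      rcases lt_trichotomy c 0 with h | h | h
      · exact h
      · subst h; simp at hc; exact absurd hc h2
      · exact absurd hc (hnp c h)
    exact two_sides_opp h1 hf hc0 hc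
  · exact two_sides_pos hε hf h

variable {P N : Set (ℝ × ℝ)} {u w : ℝ}

lemma Core.closed (C : Core P N u w) : IsClosed P := C.cpt.isClosed

lemma Core.fr (C : Core P N u w) : frontier P ⊆ P := C.closed.frontier_subset

lemma Core.locConn (C : Core P N u w) {x : ℝ × ℝ} (hx : x ∈ frontier P) :
    ∃ ε > 0, IsPreconnected (Metric.ball x ε \ P) := by
  obtain ⟨ε, hε, S1, S2, p1, p2, hs, hb⟩ := (C.loc x hx).two_sides
  refine ⟨ε, hε, ?_⟩
  have r1 := dichot p1 (fun q hq => (hs q (Or.inl hq)).2)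
  have r2 := dichot p2 (fun q hq => (hs q (Or.inr hq)).2)
  have hbP : ∀ q ∈ Metric.ball x ε, q ∉ P → q ∈ S1 ∪ S2 := fun q hq hP => hb q hq (fun h => hP (C.fr h))
  have hcl : x ∈ closure (interior P) := C.reg ▸ C.fr hx
  obtain ⟨y, hy1, hy2⟩ := Metric.mem_closure_iff.1 hcl ε hε
  rw [dist_comm] at hy2
  have hyS := hb y hy2 (fun h => h.2 hy1)
  have hyP := interior_subset hy1
  rcases r1 with r1 | r1 <;> rcases r2 with r2 | r2
  · convert isPreconnected_empty
    ext q; constructor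
    · rintro ⟨h1, h2⟩
      rcases hbP q h1 h2 with h | h
      exacts [(h2 (r1 h)).elim, (h2 (r2 h)).elim]
    · exact fun h => h.elim
  · convert p2
    ext q; constructor
    · rintro ⟨h1, h2⟩
      rcases hbP q h1 h2 with h | h
      exacts [(h2 (r1 h)).elim, h]
    · exact fun h => ⟨(hs q (Or.inr h)).1, r2 h⟩
  · convert p1
    ext q; constructor
    · rintro ⟨h1, h2⟩
      rcases hbP q h1 h2 with h | h
      exacts [h, (h2 (r2 h)).elim]
    · exact fun h => ⟨(hs q (Or.inl h)).1, r1 h⟩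
  · rcases hyS with h | h
    exacts [(r1 h hyP).elim, (r2 h hyP).elim]

lemma frontier_ne {S : Set (ℝ × ℝ)} (h1 : S.Nonempty) (h2 : S ≠ Set.univ) : (frontier S).Nonempty :=
  nonempty_frontier_iff.2 ⟨h1, h2⟩

lemma Core.fill (C : Core P N u w) {U : Set (ℝ × ℝ)} (hU : IsOpen U) (hb : Bornology.IsBounded U)
    (hfU : frontier U ⊆ P) : U ⊆ P := by
  by_contra hcon
  rw [Set.not_subset] at hcon
  obtain ⟨a, haU, haP⟩ := hcon
  have hPo : IsOpen Pᶜ := C.closed.isOpen_compl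
  set W := U \ P with hW
  set W' := Pᶜ \ closure U with hW'
  have oW : IsOpen W := hU.inter hPo
  have oW' : IsOpen W' := hPo.inter isClosed_closure.isOpen_compl
  have cover : Pᶜ ⊆ W ∪ W' := by
    intro q hq
    by_cases h : q ∈ U
    · exact Or.inl ⟨h, hq⟩
    · refine Or.inr ⟨hq, fun h2 => hq (hfU ⟨h2, ?_⟩)⟩
      rwa [hU.interior_eq]
  have disj : ∀ q, q ∈ W → q ∈ W' → False := fun q h1 h2 => h2.2 (subset_closure h1.1)
  -- frontier of W is in frontier of P
  have fsub : ∀ {A B : Set (ℝ × ℝ)}, IsOpen A → IsOpen B → Pᶜ ⊆ A ∪ B → A ⊆ Pᶜ →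
      (∀ q, q ∈ A → q ∈ B → False) → frontier A ⊆ frontier P := by
    intro A B oA oB cov hA dis q hq
    rw [← frontier_compl]
    refine ⟨closure_mono hA (hq : q ∈ closure A \ interior A).1, ?_⟩
    rw [hPo.interior_eq]
    intro hqP
    rw [oA.frontier_eq] at hq
    rcases cov hqP with h | h
    · exact hq.2 h
    · obtain ⟨z, hz1, hz2⟩ := mem_closure_iff.1 hq.1 B oB h
      exact dis z hz2 hz1
  have nb : ¬ Bornology.IsBounded (Set.univ : Set (ℝ × ℝ)) := by
    intro h
    exact NoncompactSpace.noncompact_univ (X := ℝ × ℝ) (Metric.isCompact_of_isClosed_isBounded isClosed_univ h)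
  have neW' : W'.Nonempty := by
    by_contra h
    rw [Set.not_nonempty_iff_eq_empty] at h
    apply nb
    apply (C.cpt.isBounded.union hb).subset
    intro q _
    by_cases hq : q ∈ P
    · exact Or.inl hq
    · rcases cover hq with h1 | h1
      · exact Or.inr h1.1
      · rw [h] at h1; exact h1.elim
  have nuW : W ≠ Set.univ := by
    intro h
    obtain ⟨b, hb⟩ := neW'
    exact disj b (h ▸ Set.mem_univ b) hb
  have nuW' : W' ≠ Set.univ := by
    intro h
    exact disj a ⟨haU, haP⟩ (h ▸ Set.mem_univ a)
  have f1 := fsub oW oW' cover (fun q h => h.2) disj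
  have f2 := fsub oW' oW (by rwa [Set.union_comm]) (fun q h => h.1) (fun q h1 h2 => disj q h2 h1)
  have neW : W.Nonempty := ⟨a, haU, haP⟩
  obtain ⟨z1, hz1⟩ := frontier_ne neW nuW
  obtain ⟨z2, hz2⟩ := frontier_ne neW' nuW'
  have cov2 : frontier P ⊆ closure W ∪ closure W' := by
    rw [← closure_union, ← frontier_compl]
    exact fun q hq => closure_mono cover hq.1
  obtain ⟨x, hx, hx1, hx2⟩ := isPreconnected_closed_iff.1 C.conn (closure W) (closure W') isClosed_closure
    isClosed_closure cov2 ⟨z1, f1 hz1, hz1.1⟩ ⟨z2, f2 hz2, hz2.1⟩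
  obtain ⟨ε, hε, hpc⟩ := C.locConn hx
  obtain ⟨y1, hy1, hy1'⟩ := mem_closure_iff.1 hx1 _ Metric.isOpen_ball (Metric.mem_ball_self hε)
  obtain ⟨y2, hy2, hy2'⟩ := mem_closure_iff.1 hx2 _ Metric.isOpen_ball (Metric.mem_ball_self hε)
  obtain ⟨q, hq, hq1, hq2⟩ := hpc W W' oW oW' (fun q hq => cover hq.2) ⟨y1, ⟨hy1, hy1'.2⟩, hy1'⟩
    ⟨y2, ⟨hy2, hy2'.1⟩, hy2'⟩
  exact disj q hq1 hq2

lemma Core.cone (C : Core P N u w) {x : ℝ × ℝ} (hx : x ∈ P) : ∃ ε > 0, ∀ h ∈ Metric.ball x ε,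
    ∀ t : ℝ, 0 < t → t ≤ 1 → (x + t • (h - x) ∈ P ↔ h ∈ P) := by
  have inball : ∀ ε : ℝ, ∀ h ∈ Metric.ball x ε, ∀ t : ℝ, 0 < t → t ≤ 1 → x + t • (h - x) ∈ Metric.ball x ε := by
    intro ε h hh t h0 h1
    have hε : 0 < ε := lt_of_le_of_lt dist_nonneg hh
    have := (convex_ball x ε).add_smul_sub_mem (Metric.mem_ball_self hε) hh ⟨h0.le, h1⟩
    exact this
  by_cases hxi : x ∈ interior P
  · obtain ⟨ε, hε, hb⟩ := Metric.isOpen_iff.1 isOpen_interior x hxi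
    refine ⟨ε, hε, fun h hh t h0 h1 => ?_⟩
    have := interior_subset (hb (inball ε h hh t h0 h1))
    have := interior_subset (hb hh)
    tauto
  · have hxf : x ∈ frontier P := ⟨subset_closure hx, hxi⟩
    obtain ⟨ε, hε, d1, d2, hd1, hd2, hf, -⟩ := C.loc x hxf
    refine ⟨ε, hε, fun h hh t h0 h1 => ?_⟩
    have key : ∀ s : ℝ, 0 < s → s ≤ 1 → (x + s • (h - x) ∈ frontier P ↔ h ∈ frontier P) := by
      intro s s0 s1
      rw [hf _ (inball ε h hh s s0 s1), hf h hh]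
      constructor
      · rintro ⟨r, hr, e | e⟩
        · refine ⟨r / s, by positivity, Or.inl ?_⟩
          rw [add_right_inj] at e
          rw [div_eq_inv_mul, mul_smul, ← e, smul_smul, inv_mul_cancel₀ s0.ne', one_smul]; abel
        · refine ⟨r / s, by positivity, Or.inr ?_⟩
          rw [add_right_inj] at e
          rw [div_eq_inv_mul, mul_smul, ← e, smul_smul, inv_mul_cancel₀ s0.ne', one_smul]; abel
      · rintro ⟨r, hr, e | e⟩
        · refine ⟨s * r, by positivity, Or.inl ?_⟩
          rw [e, mul_smul]; congr 2; abel
        · refine ⟨s * r, by positivity, Or.inr ?_⟩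
          rw [e, mul_smul]; congr 2; abel
    by_cases hhf : h ∈ frontier P
    · have := C.fr hhf
      have := C.fr ((key t h0 h1).2 hhf)
      tauto
    · have hS : IsPreconnected (segment ℝ (x + t • (h - x)) h) := (convex_segment _ _).isPreconnected
      have := dichot (P := P) hS (by
        intro q hq
        have : ∃ s : ℝ, 0 < s ∧ s ≤ 1 ∧ q = x + s • (h - x) := by
          rw [segment_eq_image] at hq
          obtain ⟨θ, ⟨t0, t1⟩, rfl⟩ := hq
          refine ⟨(1 - θ) * t + θ, ?_, ?_, ?_⟩
          · rcases eq_or_lt_of_le t0 with h | h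
            · rw [← h]; linarith
            · nlinarith [mul_nonneg (sub_nonneg.2 t1) h0.le]
          · nlinarith
          · module
        obtain ⟨s, s0, s1, rfl⟩ := this
        rw [key s s0 s1]; exact hhf)
      have a1 := left_mem_segment ℝ (x + t • (h - x)) h
      have a2 := right_mem_segment ℝ (x + t • (h - x)) h
      rcases this with h | h
      · have := h a1; have := h a2; tauto
      · have := h a1; have := h a2; simp only [Set.mem_compl_iff] at *; tauto

lemma Core.lemE (C : Core P N u w) {t : ℝ} (h1 : u < t) (h2 : t < w) :
    ∃ ρ > 0, ∀ q ∈ Metric.ball ((t, 0) : ℝ × ℝ) ρ, 0 ≤ q.2 → q ∈ P := by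
  have eseg : ∀ r : ℝ, u ≤ r → r ≤ w → ((r, 0) : ℝ × ℝ) ∈ frontier P := by
    intro r hr1 hr2
    apply C.edge
    have := C.huw
    rw [mem_seg]
    refine ⟨(r - u) / (w - u), div_nonneg (by linarith) (by linarith), ?_, ?_, ?_⟩
    · rw [div_le_one (by linarith)]; linarith
    · have : w - u ≠ 0 := by linarith
      simp; field_simp; ring
    · simp
  obtain ⟨ε, hε, d1, d2, hd1, hd2, hf, -⟩ := C.loc _ (eseg t h1.le h2.le)
  obtain ⟨ρ, hρ, hρε, hρ1, hρ2⟩ : ∃ ρ > 0, ρ ≤ ε ∧ ρ < t - u ∧ ρ < w - t :=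
    ⟨min ε (min ((t-u)/2) ((w-t)/2)), by
      refine lt_min hε (lt_min ?_ ?_) <;> linarith, min_le_left _ _,
      lt_of_le_of_lt ((min_le_right _ _).trans (min_le_left _ _)) (by linarith),
      lt_of_le_of_lt ((min_le_right _ _).trans (min_le_right _ _)) (by linarith)⟩
  have hp : ((t + ρ / 2, 0) : ℝ × ℝ) ∈ Metric.ball ((t, 0) : ℝ × ℝ) ε := by
    rw [Metric.mem_ball, Prod.dist_eq]
    simp [abs_of_pos hρ]; constructor <;> linarith
  have hm : ((t - ρ / 2, 0) : ℝ × ℝ) ∈ Metric.ball ((t, 0) : ℝ × ℝ) ε := by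
    rw [Metric.mem_ball, Prod.dist_eq]
    simp [abs_of_pos hρ]; constructor <;> linarith
  have fp := (hf _ hp).1 (eseg _ (by linarith) (by linarith))
  have fm := (hf _ hm).1 (eseg _ (by linarith) (by linarith))
  have hh : d1.2 = 0 ∧ d2.2 = 0 := by
    obtain ⟨s, hs, e | e⟩ := fp <;> obtain ⟨r, hr, e' | e'⟩ := fm <;>
    · have a1 := congrArg Prod.fst e
      have a2 := congrArg Prod.snd e
      have b1 := congrArg Prod.fst e'
      have b2 := congrArg Prod.snd e'
      simp at a1 a2 b1 b2
      first
      | (exfalso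
         have s0 : 0 < s := lt_of_le_of_ne hs (by rintro rfl; simp at a1; linarith)
         have r0 : 0 < r := lt_of_le_of_ne hr (by rintro rfl; simp at b1; linarith)
         nlinarith)
      | (have s0 : s ≠ 0 := by rintro rfl; simp at a1; linarith
         have r0 : r ≠ 0 := by rintro rfl; simp at b1; linarith
         constructor <;> tauto)
  have hray : ∀ q ∈ Metric.ball ((t, 0) : ℝ × ℝ) ε, q ∈ frontier P → q.2 = 0 := by
    intro q hq hqf
    obtain ⟨s, hs, rfl | rfl⟩ := (hf q hq).1 hqf <;> simp [hh.1, hh.2]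
  have cS : Convex ℝ (Metric.ball ((t, 0) : ℝ × ℝ) ε ∩ {q | 0 < q.2}) := by
    apply (convex_ball _ _).inter
    have := convex_pos 0 1 0
    simpa using this
  have hd := dichot (P := P) cS.isPreconnected (fun q hq hqf => by
    have := hray q hq.1 hqf
    have := hq.2
    simp only [Set.mem_ofPred_eq] at this
    linarith)
  have hsub : Metric.ball ((t, 0) : ℝ × ℝ) ε ∩ {q | 0 < q.2} ⊆ P := by
    rcases hd with h | h
    · exact h
    · exfalso
      have hcl : ((t, 0) : ℝ × ℝ) ∈ closure (interior P) := C.reg ▸ C.fr (eseg t h1.le h2.le)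
      obtain ⟨y, hy1, hy2⟩ := Metric.mem_closure_iff.1 hcl ε hε
      rw [dist_comm] at hy2
      have hyP := interior_subset hy1
      rcases eq_or_lt_of_le (C.half y hyP) with h0 | h0
      · obtain ⟨δ, hδ, hb⟩ := Metric.isOpen_iff.1 isOpen_interior y hy1
        obtain ⟨s, hs, hm⟩ := small_mem y (0, -1) hδ
        have := C.half _ (interior_subset (hb hm))
        simp at this; linarith
      · exact h ⟨hy2, h0⟩ hyP
  refine ⟨ρ, hρ, fun q hq hq2 => ?_⟩
  rcases eq_or_lt_of_le hq2 with h0 | h0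
  · rw [Metric.mem_ball, Prod.dist_eq, max_lt_iff, Real.dist_eq, abs_lt] at hq
    have : q = (q.1, 0) := Prod.ext rfl h0.symm
    rw [this]
    simp only at hq
    exact C.fr (eseg _ (by linarith [hq.1.1]) (by linarith [hq.1.2]))
  · exact hsub ⟨Metric.ball_subset_ball hρε hq, h0⟩

end WV


namespace WV

def Vis (P : Set (ℝ × ℝ)) (A B : ℝ × ℝ) : Prop := segment ℝ A B ⊆ P

def ln (A B : ℝ × ℝ) (t : ℝ) : ℝ × ℝ := (A.1 + t * (B.1 - A.1), A.2 + t * (B.2 - A.2))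

@[simp] lemma ln_fst (A B : ℝ × ℝ) (t : ℝ) : (ln A B t).1 = A.1 + t * (B.1 - A.1) := rfl
@[simp] lemma ln_snd (A B : ℝ × ℝ) (t : ℝ) : (ln A B t).2 = A.2 + t * (B.2 - A.2) := rfl
@[simp] lemma ln_zero (A B : ℝ × ℝ) : ln A B 0 = A := by ext <;> simp
@[simp] lemma ln_one (A B : ℝ × ℝ) : ln A B 1 = B := by ext <;> simp

lemma mem_seg_ln {A B q : ℝ × ℝ} : q ∈ segment ℝ A B ↔ ∃ t : ℝ, 0 ≤ t ∧ t ≤ 1 ∧ q = ln A B t := by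
  rw [mem_seg]
  constructor
  · rintro ⟨t, h0, h1, a, b⟩
    exact ⟨t, h0, h1, Prod.ext a b⟩
  · rintro ⟨t, h0, h1, rfl⟩
    exact ⟨t, h0, h1, rfl, rfl⟩

lemma ln_mem_seg {A B : ℝ × ℝ} {t : ℝ} (h0 : 0 ≤ t) (h1 : t ≤ 1) : ln A B t ∈ segment ℝ A B :=
  mem_seg_ln.2 ⟨t, h0, h1, rfl⟩

lemma ln_between {A B : ℝ × ℝ} {s r t : ℝ} (h0 : s ≤ r) (h1 : r ≤ t) :
    ln A B r ∈ segment ℝ (ln A B s) (ln A B t) := by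
  rcases eq_or_lt_of_le (h0.trans h1) with h | h
  · have : r = s := by linarith
    rw [this]; exact left_mem_segment ℝ _ _
  · rw [mem_seg]
    have : t - s ≠ 0 := by linarith
    refine ⟨(r - s) / (t - s), div_nonneg (by linarith) (by linarith), ?_, ?_, ?_⟩
    · rw [div_le_one (by linarith)]; linarith
    · simp; field_simp; ring
    · simp; field_simp; ring

lemma of_ln_between {A B q : ℝ × ℝ} {s t : ℝ} (hst : s ≤ t) (h : q ∈ segment ℝ (ln A B s) (ln A B t)) :
    ∃ r, s ≤ r ∧ r ≤ t ∧ q = ln A B r := by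
  obtain ⟨θ, h0, h1, ha, hb⟩ := mem_seg.1 h
  refine ⟨s + θ * (t - s), ?_, ?_, ?_⟩
  · nlinarith
  · nlinarith
  · ext
    · rw [ha]; simp; ring
    · rw [hb]; simp; ring

variable {P N : Set (ℝ × ℝ)} {u w : ℝ} {A B D q : ℝ × ℝ}

lemma Vis.symm (h : Vis P A B) : Vis P B A := by
  unfold Vis at *; rwa [segment_symm]

lemma Vis.left (h : Vis P A B) : A ∈ P := h (left_mem_segment ℝ _ _)
lemma Vis.right (h : Vis P A B) : B ∈ P := h (right_mem_segment ℝ _ _)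

lemma vis_self (h : A ∈ P) : Vis P A A := by
  intro q hq; rw [segment_same] at hq; rw [hq]; exact h

lemma seg_sub {x y : ℝ × ℝ} (hx : x ∈ segment ℝ A B) (hy : y ∈ segment ℝ A B) :
    segment ℝ x y ⊆ segment ℝ A B := (convex_segment A B).segment_subset hx hy

lemma Vis.sub (h : Vis P A B) {x y : ℝ × ℝ} (hx : x ∈ segment ℝ A B) (hy : y ∈ segment ℝ A B) :
    Vis P x y := (seg_sub hx hy).trans h

lemma Vis.subl (h : Vis P A B) {x : ℝ × ℝ} (hx : x ∈ segment ℝ A B) : Vis P A x :=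
  h.sub (left_mem_segment ℝ _ _) hx
lemma Vis.subr (h : Vis P A B) {x : ℝ × ℝ} (hx : x ∈ segment ℝ A B) : Vis P x B :=
  h.sub hx (right_mem_segment ℝ _ _)

/-- gluing along a line -/
lemma vis_glue {s r t : ℝ} (h1 : Vis P (ln A B s) (ln A B r)) (h2 : Vis P (ln A B r) (ln A B t))
    (hsr : s ≤ r) (hrt : r ≤ t) : Vis P (ln A B s) (ln A B t) := by
  intro q hq
  obtain ⟨x, hx1, hx2, rfl⟩ := of_ln_between (hsr.trans hrt) hq
  rcases le_total x r with h | h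
  · exact h1 (ln_between hx1 h)
  · exact h2 (ln_between h hx2)

def Tri (A B C : ℝ × ℝ) : Set (ℝ × ℝ) := convexHull ℝ {A, B, C}

lemma mem_tri {A B C q : ℝ × ℝ} : q ∈ Tri A B C ↔ ∃ a b c : ℝ, 0 ≤ a ∧ 0 ≤ b ∧ 0 ≤ c ∧ a + b + c = 1 ∧
    q.1 = a * A.1 + b * B.1 + c * C.1 ∧ q.2 = a * A.2 + b * B.2 + c * C.2 := by
  unfold Tri
  rw [convexHull_insert (by simp), convexHull_pair, mem_convexJoin]
  constructor
  · rintro ⟨x, hx, y, hy, hq⟩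
    rw [Set.mem_singleton_iff] at hx; subst hx
    obtain ⟨t, t0, t1, a1, a2⟩ := mem_seg.1 hy
    obtain ⟨s, s0, s1, b1, b2⟩ := mem_seg.1 hq
    refine ⟨1 - s, s * (1 - t), s * t, by linarith, mul_nonneg s0 (by linarith), by positivity, by ring, ?_, ?_⟩
    · rw [b1, a1]; ring
    · rw [b2, a2]; ring
  · rintro ⟨a, b, c, ha, hb, hc, hs, h1, h2⟩
    refine ⟨A, rfl, ?_⟩
    rcases eq_or_lt_of_le (add_nonneg hb hc) with h | h
    · have hb0 : b = 0 := by linarith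
      have hc0 : c = 0 := by linarith
      have ha1 : a = 1 := by linarith
      refine ⟨B, left_mem_segment ℝ _ _, ?_⟩
      have : q = A := by ext <;> simp [h1, h2, hb0, hc0, ha1]
      rw [this]; exact left_mem_segment ℝ _ _
    · have hne : b + c ≠ 0 := h.ne'
      refine ⟨ln B C (c / (b + c)), ln_mem_seg (by positivity) (by rw [div_le_one h]; linarith), ?_⟩
      rw [mem_seg]
      have ha' : a = 1 - b - c := by linarith
      refine ⟨b + c, h.le, by linarith, ?_, ?_⟩
      · rw [h1, ha']; simp; field_simp; ring
      · rw [h2, ha']; simp; field_simp; ring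

lemma tri_of_cr {A B C q : ℝ × ℝ} (h : 0 < cr A B C) (h1 : 0 ≤ cr A B q) (h2 : 0 ≤ cr B C q)
    (h3 : 0 ≤ cr C A q) : q ∈ Tri A B C := by
  rw [mem_tri]
  refine ⟨cr B C q / cr A B C, cr C A q / cr A B C, cr A B q / cr A B C, by positivity, by positivity,
    by positivity, ?_, ?_, ?_⟩
  · field_simp; simp only [cr]; ring
  · field_simp; simp only [cr]; ring
  · field_simp; simp only [cr]; ring

lemma seg_of_cr {A B C q : ℝ × ℝ} (h : cr A B C ≠ 0) (h1 : cr A B q = 0) (h2 : 0 ≤ cr B C q / cr A B C)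
    (h3 : 0 ≤ cr C A q / cr A B C) : q ∈ segment ℝ A B := by
  rw [mem_seg]
  have e : cr B C q + cr C A q + cr A B q = cr A B C := by simp only [cr]; ring
  rw [h1, add_zero] at e
  have e2 : cr B C q / cr A B C + cr C A q / cr A B C = 1 := by
    rw [← add_div, e]; exact div_self h
  refine ⟨cr C A q / cr A B C, h3, by linarith, ?_, ?_⟩
  · field_simp
    simp only [cr] at *; linear_combination (C.1 - A.1) * h1
  · field_simp
    simp only [cr] at *; linear_combination (C.2 - A.2) * h1

lemma continuous_cr (A B : ℝ × ℝ) : Continuous (fun q => cr A B q) := by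
  unfold cr; fun_prop

lemma isOpen_cr (A B : ℝ × ℝ) : IsOpen {q | 0 < cr A B q} :=
  isOpen_lt continuous_const (continuous_cr A B)
lemma isOpen_cr' (A B : ℝ × ℝ) : IsOpen {q | cr A B q < 0} :=
  isOpen_lt (continuous_cr A B) continuous_const

lemma isCompact_tri (A B C : ℝ × ℝ) : IsCompact (Tri A B C) :=
  Set.Finite.isCompact_convexHull ℝ (by simp)

lemma cr_cyc (A B C : ℝ × ℝ) : cr B C A = cr A B C := by simp only [cr]; ring
lemma cr_swap (A B C : ℝ × ℝ) : cr B A C = - cr A B C := by simp only [cr]; ring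
lemma cr_swap' (A B C : ℝ × ℝ) : cr A C B = - cr A B C := by simp only [cr]; ring

lemma tri_perm (A B C : ℝ × ℝ) : Tri B C A = Tri A B C := by
  unfold Tri; congr 1; ext x; simp; tauto
lemma tri_swap (A B C : ℝ × ℝ) : Tri B A C = Tri A B C := by
  unfold Tri; congr 1; ext x; simp; tauto

/-- barycentric positions give cross products -/
lemma tri_cases {A B C q : ℝ × ℝ} (hq : q ∈ Tri A B C) (h : 0 < cr A B C) :
    0 ≤ cr A B q ∧ 0 ≤ cr B C q ∧ 0 ≤ cr C A q := by
  obtain ⟨a, b, c, ha, hb, hc, hs, h1, h2⟩ := mem_tri.1 hq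
  have e1 : cr A B q = c * cr A B C := by
    have : a = 1 - b - c := by linarith
    simp only [cr, h1, h2, this]; ring
  have e2 : cr B C q = a * cr A B C := by
    have : a = 1 - b - c := by linarith
    simp only [cr, h1, h2, this]; ring
  have e3 : cr C A q = b * cr A B C := by
    have : a = 1 - b - c := by linarith
    simp only [cr, h1, h2, this]; ring
  rw [e1, e2, e3]
  refine ⟨?_, ?_, ?_⟩ <;> positivity

lemma Core.tri_pos (K : Core P N u w) {A B C : ℝ × ℝ} (h : 0 < cr A B C) (h1 : Vis P A B) (h2 : Vis P B C)
    (h3 : Vis P C A) : Tri A B C ⊆ P := by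
  set U : Set (ℝ × ℝ) := {q | 0 < cr A B q} ∩ {q | 0 < cr B C q} ∩ {q | 0 < cr C A q} with hU
  have oU : IsOpen U := ((isOpen_cr A B).inter (isOpen_cr B C)).inter (isOpen_cr C A)
  have sub : U ⊆ Tri A B C := fun q hq => tri_of_cr h (le_of_lt hq.1.1) (le_of_lt hq.1.2) (le_of_lt hq.2)
  have key : ∀ q ∈ Tri A B C, q ∈ U ∨ q ∈ P := by
    intro q hq
    obtain ⟨c1, c2, c3⟩ := tri_cases hq h
    rcases eq_or_lt_of_le c1 with e1 | e1
    · right; apply h1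
      exact seg_of_cr (C := C) h.ne' e1.symm (by positivity) (by positivity)
    rcases eq_or_lt_of_le c2 with e2 | e2
    · right; apply h2
      have hh : 0 < cr B C A := by rwa [cr_cyc]
      exact seg_of_cr (C := A) hh.ne' e2.symm (by positivity) (by positivity)
    rcases eq_or_lt_of_le c3 with e3 | e3
    · right; apply h3
      have hh : 0 < cr C A B := by rwa [cr_cyc, cr_cyc]
      exact seg_of_cr (C := B) hh.ne' e3.symm (by positivity) (by positivity)
    exact Or.inl ⟨⟨e1, e2⟩, e3⟩
  have hUP : U ⊆ P := by
    apply K.fill oU ((isCompact_tri A B C).isBounded.subset sub)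
    intro q hq
    rw [oU.frontier_eq] at hq
    have : q ∈ Tri A B C := closure_minimal sub (isCompact_tri A B C).isClosed hq.1
    exact (key q this).resolve_left hq.2
  intro q hq
  rcases key q hq with h | h
  · exact hUP h
  · exact h

lemma Core.tri (K : Core P N u w) {A B C : ℝ × ℝ} (h1 : Vis P A B) (h2 : Vis P B C)
    (h3 : Vis P C A) : Tri A B C ⊆ P := by
  rcases lt_trichotomy (cr A B C) 0 with h | h | h
  · rw [← tri_swap]
    exact K.tri_pos (by rw [cr_swap]; linarith) h1.symm h3.symm h2.symm
  · -- degenerate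
    have hcol : Collinear ℝ ({A, B, C} : Set (ℝ × ℝ)) := by
      by_cases hAB : A = B
      · subst hAB
        simp only [Set.insert_eq_of_mem, Set.mem_insert_iff, true_or]
        exact collinear_pair ℝ A C
      · rw [collinear_iff_of_mem (p₀ := A) (by simp)]
        refine ⟨B - A, ?_⟩
        intro p hp
        simp only [Set.mem_insert_iff, Set.mem_singleton_iff] at hp
        rcases hp with rfl | rfl | rfl
        · exact ⟨0, by simp⟩
        · exact ⟨1, by simp⟩
        · by_cases hx : B.1 = A.1
          · have hy : B.2 - A.2 ≠ 0 := fun hy => hAB (Prod.ext hx.symm (by linarith))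
            refine ⟨(p.2 - A.2) / (B.2 - A.2), ?_⟩
            have : p.1 = A.1 := by
              simp only [cr, hx] at h
              have : (B.2 - A.2) * (p.1 - A.1) = 0 := by linarith
              have := (mul_eq_zero.1 this).resolve_left hy
              linarith
            ext
            · simp [hx, this]
            · simp; field_simp; ring
          · have hx' : B.1 - A.1 ≠ 0 := sub_ne_zero.2 hx
            refine ⟨(p.1 - A.1) / (B.1 - A.1), ?_⟩
            ext
            · simp; field_simp; ring
            · simp only [cr] at h
              simp; field_simp; linarith
    have tsub : ∀ {X Y Z : ℝ × ℝ}, Wbtw ℝ X Y Z → Tri X Y Z ⊆ segment ℝ X Z := by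
      intro X Y Z hw
      unfold Tri
      apply convexHull_min _ (convex_segment X Z)
      intro x hx
      simp only [Set.mem_insert_iff, Set.mem_singleton_iff] at hx
      rcases hx with rfl | rfl | rfl
      · exact left_mem_segment ℝ _ _
      · exact hw.mem_segment
      · exact right_mem_segment ℝ _ _
    rcases hcol.wbtw_or_wbtw_or_wbtw with hw | hw | hw
    · exact (tsub hw).trans h3.symm
    · rw [← tri_perm]; exact (tsub hw).trans h1.symm
    · rw [← tri_perm, ← tri_perm]; exact (tsub hw).trans h2.symm
  · exact K.tri_pos h h1 h2 h3

lemma Core.vis_tri (K : Core P N u w) {A B C x y : ℝ × ℝ} (h1 : Vis P A B) (h2 : Vis P B C)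
    (h3 : Vis P C A) (hx : x ∈ Tri A B C) (hy : y ∈ Tri A B C) : Vis P x y :=
  ((convex_convexHull ℝ _).segment_subset hx hy).trans (K.tri h1 h2 h3)

lemma tri_a (A B C : ℝ × ℝ) : A ∈ Tri A B C := subset_convexHull ℝ _ (by simp)
lemma tri_b (A B C : ℝ × ℝ) : B ∈ Tri A B C := subset_convexHull ℝ _ (by simp)
lemma tri_c (A B C : ℝ × ℝ) : C ∈ Tri A B C := subset_convexHull ℝ _ (by simp)
lemma tri_seg {A B C x y z : ℝ × ℝ} (hx : x ∈ Tri A B C) (hy : y ∈ Tri A B C) (hz : z ∈ segment ℝ x y) :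
    z ∈ Tri A B C := (convex_convexHull ℝ _).segment_subset hx hy hz

lemma Core.diag (K : Core P N u w) {A B C D : ℝ × ℝ} (hC : 0 < cr A B C) (hD : cr A B D < 0)
    (h1 : Vis P A C) (h2 : Vis P C B) (h3 : Vis P B D) (h4 : Vis P D A) : Vis P A B := by
  set T1 : Set (ℝ × ℝ) := {q | 0 < cr A B q} ∩ {q | 0 < cr B C q} ∩ {q | 0 < cr C A q} with hT1
  set T2 : Set (ℝ × ℝ) := {q | cr A B q < 0} ∩ {q | cr B D q < 0} ∩ {q | cr D A q < 0} with hT2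
  set O : Set (ℝ × ℝ) := ({q | 0 < cr B C q} ∩ {q | 0 < cr C A q}) ∩ ({q | cr B D q < 0} ∩ {q | cr D A q < 0}) with hO
  have oU : IsOpen (T1 ∪ T2 ∪ O) :=
    ((((isOpen_cr _ _).inter (isOpen_cr _ _)).inter (isOpen_cr _ _)).union
    (((isOpen_cr' _ _).inter (isOpen_cr' _ _)).inter (isOpen_cr' _ _))).union
    (((isOpen_cr _ _).inter (isOpen_cr _ _)).inter ((isOpen_cr' _ _).inter (isOpen_cr' _ _)))
  have hD' : 0 < cr B A D := by rw [cr_swap]; linarith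
  have s1 : T1 ⊆ Tri A B C := fun q hq => tri_of_cr hC (le_of_lt hq.1.1) (le_of_lt hq.1.2) (le_of_lt hq.2)
  have s2 : T2 ⊆ Tri B A D := fun q hq => by
    obtain ⟨⟨a, b⟩, c⟩ := hq
    simp only [Set.mem_ofPred_eq] at a b c
    apply tri_of_cr hD'
    · rw [cr_swap]; linarith
    · rw [cr_swap]; linarith
    · rw [cr_swap]; linarith
  have sub : T1 ∪ T2 ∪ O ⊆ Tri A B C ∪ Tri B A D := by
    rintro q ((hq | hq) | ⟨⟨o1, o2⟩, ⟨o3, o4⟩⟩)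
    · exact Or.inl (s1 hq)
    · exact Or.inr (s2 hq)
    · simp only [Set.mem_ofPred_eq] at o1 o2 o3 o4
      rcases le_total 0 (cr A B q) with h | h
      · exact Or.inl (tri_of_cr hC h o1.le o2.le)
      · right
        apply tri_of_cr hD'
        · rw [cr_swap]; linarith
        · rw [cr_swap]; linarith
        · rw [cr_swap]; linarith
  have kAB : ∀ q ∈ segment ℝ A B, q ∈ O ∨ q ∈ P := by
    intro q hq
    obtain ⟨t, t0, t1, a1, a2⟩ := mem_seg.1 hq
    rcases eq_or_lt_of_le t0 with e | e
    · right
      have : q = A := by ext <;> simp [a1, a2, ← e]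
      rw [this]; exact h1.left
    rcases eq_or_lt_of_le t1 with e' | e'
    · right
      have : q = B := by ext <;> simp [a1, a2, e']
      rw [this]; exact h2.right
    left
    have e1 : cr B C q = (1 - t) * cr A B C := by simp only [cr, a1, a2]; ring
    have e2 : cr C A q = t * cr A B C := by simp only [cr, a1, a2]; ring
    have e3 : cr B D q = (1 - t) * cr A B D := by simp only [cr, a1, a2]; ring
    have e4 : cr D A q = t * cr A B D := by simp only [cr, a1, a2]; ring
    have t1' : 0 < 1 - t := by linarith
    refine ⟨⟨?_, ?_⟩, ⟨?_, ?_⟩⟩ <;> simp only [Set.mem_ofPred_eq]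
    · rw [e1]; positivity
    · rw [e2]; positivity
    · rw [e3]; exact mul_neg_of_pos_of_neg t1' hD
    · rw [e4]; exact mul_neg_of_pos_of_neg e hD
  have k1 : ∀ q ∈ Tri A B C, q ∈ T1 ∪ T2 ∪ O ∨ q ∈ P := by
    intro q hq
    obtain ⟨c1, c2, c3⟩ := tri_cases hq hC
    rcases eq_or_lt_of_le c2 with e2 | e2
    · right; apply h2.symm
      have hh : 0 < cr B C A := by rwa [cr_cyc]
      exact seg_of_cr (C := A) hh.ne' e2.symm (by positivity) (by positivity)
    rcases eq_or_lt_of_le c3 with e3 | e3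
    · right; apply h1.symm
      have hh : 0 < cr C A B := by rwa [cr_cyc, cr_cyc]
      exact seg_of_cr (C := B) hh.ne' e3.symm (by positivity) (by positivity)
    rcases eq_or_lt_of_le c1 with e1 | e1
    · rcases kAB q (seg_of_cr (C := C) hC.ne' e1.symm (by positivity) (by positivity)) with h | h
      · exact Or.inl (Or.inr h)
      · exact Or.inr h
    exact Or.inl (Or.inl (Or.inl ⟨⟨e1, e2⟩, e3⟩))
  have k2 : ∀ q ∈ Tri B A D, q ∈ T1 ∪ T2 ∪ O ∨ q ∈ P := by
    intro q hq
    obtain ⟨c1, c2, c3⟩ := tri_cases hq hD'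
    rcases eq_or_lt_of_le c2 with e2 | e2
    · right; apply h4.symm
      have hh : 0 < cr A D B := by rwa [cr_cyc]
      exact seg_of_cr (C := B) hh.ne' e2.symm (by positivity) (by positivity)
    rcases eq_or_lt_of_le c3 with e3 | e3
    · right; apply h3.symm
      have hh : 0 < cr D B A := by rwa [cr_cyc, cr_cyc]
      exact seg_of_cr (C := A) hh.ne' e3.symm (by positivity) (by positivity)
    rcases eq_or_lt_of_le c1 with e1 | e1
    · have := seg_of_cr (C := D) hD'.ne' e1.symm (by positivity) (by positivity)
      rw [segment_symm] at this
      rcases kAB q this with h | h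
      · exact Or.inl (Or.inr h)
      · exact Or.inr h
    rw [cr_swap] at e1 e2 e3
    refine Or.inl (Or.inl (Or.inr ⟨⟨?_, ?_⟩, ?_⟩)) <;> simp only [Set.mem_ofPred_eq] <;> linarith
  have hUP : T1 ∪ T2 ∪ O ⊆ P := by
    apply K.fill oU (((isCompact_tri A B C).isBounded.union (isCompact_tri B A D).isBounded).subset sub)
    intro q hq
    rw [oU.frontier_eq] at hq
    have : q ∈ Tri A B C ∪ Tri B A D := closure_minimal sub
      ((isCompact_tri A B C).isClosed.union (isCompact_tri B A D).isClosed) hq.1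
    rcases this with h | h
    · exact (k1 q h).resolve_left hq.2
    · exact (k2 q h).resolve_left hq.2
  intro q hq
  rcases kAB q hq with h | h
  · exact hUP (Or.inr h)
  · exact h

end WV


namespace WV

def ax (t : ℝ) : ℝ × ℝ := (t, 0)
@[simp] lemma ax_fst (t : ℝ) : (ax t).1 = t := rfl
@[simp] lemma ax_snd (t : ℝ) : (ax t).2 = 0 := rfl

def IsL (P : Set (ℝ × ℝ)) (u w : ℝ) (s : ℝ × ℝ) (l : ℝ) : Prop :=
  u ≤ l ∧ l ≤ w ∧ Vis P (ax l) s ∧ ∀ t, u ≤ t → t ≤ w → Vis P (ax t) s → l ≤ t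

variable {P N : Set (ℝ × ℝ)} {u w : ℝ}

lemma IsL.unique {s : ℝ × ℝ} {l l' : ℝ} (h : IsL P u w s l) (h' : IsL P u w s l') : l = l' :=
  le_antisymm (h.2.2.2 l' h'.1 h'.2.1 h'.2.2.1) (h'.2.2.2 l h.1 h.2.1 h.2.2.1)

lemma ax_seg {x y t : ℝ} (h1 : x ≤ t) (h2 : t ≤ y) : ax t ∈ segment ℝ (ax x) (ax y) := by
  have := ln_between (A := ax 0) (B := ax 1) h1 h2
  have e : ∀ r, ln (ax 0) (ax 1) r = ax r := by intro r; ext <;> simp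
  rwa [e, e, e] at this

lemma Core.vis_ax (K : Core P N u w) {x y : ℝ} (hx1 : u ≤ x) (hx2 : x ≤ w) (hy1 : u ≤ y) (hy2 : y ≤ w) :
    Vis P (ax x) (ax y) := by
  have h : Vis P (ax u) (ax w) := K.edge.trans K.fr
  exact h.sub (ax_seg hx1 hx2) (ax_seg hy1 hy2)

lemma Core.ax_mem (K : Core P N u w) {x : ℝ} (hx1 : u ≤ x) (hx2 : x ≤ w) : ax x ∈ P :=
  (K.vis_ax hx1 hx2 hx1 hx2).left

lemma Core.exists_L (K : Core P N u w) {s : ℝ × ℝ} (hs : s ∈ P) : ∃ l, IsL P u w s l := by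
  set S : Set ℝ := {t | u ≤ t ∧ t ≤ w ∧ Vis P (ax t) s} with hS
  have hSe : S = Set.Icc u w ∩ ⋂ θ ∈ Set.Icc (0:ℝ) 1, {t | ln (ax t) s θ ∈ P} := by
    ext t
    simp only [hS, Set.mem_ofPred_eq, Set.mem_inter_iff, Set.mem_Icc, Set.mem_iInter]
    constructor
    · rintro ⟨a, b, c⟩
      exact ⟨⟨a, b⟩, fun θ hθ => c (ln_mem_seg hθ.1 hθ.2)⟩
    · rintro ⟨⟨a, b⟩, c⟩
      refine ⟨a, b, fun q hq => ?_⟩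
      obtain ⟨θ, h0, h1, rfl⟩ := mem_seg_ln.1 hq
      exact c θ ⟨h0, h1⟩
  have hc : IsCompact S := by
    rw [hSe]
    apply isCompact_Icc.inter_right
    apply isClosed_biInter
    intro θ _
    apply K.closed.preimage
    unfold ln ax; fun_prop
  have hne : S.Nonempty := by
    obtain ⟨t, h1, h2, h3⟩ := K.wv s hs
    exact ⟨t, h1, h2, h3⟩
  obtain ⟨l, hl1, hl2⟩ := hc.exists_isLeast hne
  exact ⟨l, hl1.1, hl1.2.1, hl1.2.2, fun t h1 h2 h3 => hl2 ⟨h1, h2, h3⟩⟩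

lemma Core.vis_low (K : Core P N u w) {k : ℝ × ℝ} (hk : k ∈ P) (h0 : k.2 = 0) {x : ℝ} (h1 : u ≤ x) (h2 : x ≤ w) :
    Vis P k (ax x) := by
  have hk' : k = ax k.1 := Prod.ext rfl h0
  obtain ⟨t, t1, t2, t3⟩ := K.wv k hk
  have t3 : Vis P (ax t) k := t3
  rw [hk'] at t3 ⊢
  generalize k.1 = y at *
  intro q hq
  obtain ⟨θ, a0, a1, e1, e2⟩ := mem_seg.1 hq
  simp at e1 e2
  have hq' : q = ax q.1 := Prod.ext rfl e2
  rw [hq']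
  by_cases hc : u ≤ q.1 ∧ q.1 ≤ w
  · exact K.ax_mem hc.1 hc.2
  · rw [not_and_or] at hc
    rcases hc with hc | hc <;> push Not at hc
    · exact t3.symm (ax_seg (by
        rcases le_total x y with h | h
        · nlinarith [mul_nonneg (sub_nonneg.2 a1) (sub_nonneg.2 h)]
        · nlinarith [mul_nonneg a0 (sub_nonneg.2 h)]) (by linarith))
    · exact t3 (ax_seg (by linarith) (by
        rcases le_total x y with h | h
        · nlinarith [mul_nonneg a0 (sub_nonneg.2 h)]
        · nlinarith [mul_nonneg (sub_nonneg.2 a1) (sub_nonneg.2 h)]))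

lemma Core.L_low (K : Core P N u w) {k : ℝ × ℝ} (hk : k ∈ P) (h0 : k.2 = 0) : IsL P u w k u :=
  ⟨le_rfl, K.huw.le, (K.vis_low hk h0 le_rfl K.huw.le).symm, fun _ h _ _ => h⟩

lemma coll_ln {A B q : ℝ × ℝ} (h : cr A B q = 0) (hne : B.2 - A.2 ≠ 0) :
    q = ln A B ((q.2 - A.2) / (B.2 - A.2)) := by
  simp only [cr] at h
  ext
  · simp; field_simp; linarith
  · simp; field_simp; ring

lemma crossing {A B X Y : ℝ × ℝ} (hX : 0 ≤ cr A B X) (hY : cr A B Y ≤ 0) :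
    ∃ d ∈ segment ℝ X Y, cr A B d = 0 := by
  rcases eq_or_lt_of_le hX with h | h
  · exact ⟨X, left_mem_segment ℝ _ _, h.symm⟩
  · have hpos : 0 < cr A B X - cr A B Y := by linarith
    refine ⟨ln X Y (cr A B X / (cr A B X - cr A B Y)), ln_mem_seg (by positivity) ?_, ?_⟩
    · rw [div_le_one hpos]; linarith
    · have e : ∀ t, cr A B (ln X Y t) = cr A B X + t * (cr A B Y - cr A B X) := by
        intro t; simp only [cr, ln]; ring
      rw [e]; field_simp; ring

lemma cr_ln (A B X Y : ℝ × ℝ) (t : ℝ) : cr A B (ln X Y t) = cr A B X + t * (cr A B Y - cr A B X) := by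
  simp only [cr, ln]; ring

lemma seg_ln {A B : ℝ × ℝ} {d : ℝ × ℝ} (h : d ∈ segment ℝ A B) : ∃ t, 0 ≤ t ∧ t ≤ 1 ∧ d = ln A B t := mem_seg_ln.1 h

lemma Core.lemL (K : Core P N u w) {s t : ℝ × ℝ} {b l : ℝ} (hs : 0 < s.2) (ht : 0 < t.2) (hst : Vis P s t)
    (hb : u ≤ b) (htb : Vis P t (ax b)) (hl : IsL P u w s l) (hbl : b < l) : cr (ax l) s t ≤ 0 := by
  by_contra hc
  push Not at hc
  obtain ⟨l1, l2, lv, lm⟩ := hl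
  have hbw : b ≤ w := by linarith
  have hbl' := K.vis_ax hb hbw l1 l2
  have nb : ¬ Vis P (ax b) s := fun h => by have := lm b hb hbw h; linarith
  rcases lt_trichotomy (cr (ax b) s t) 0 with h | h | h
  · have vtl : Vis P t (ax l) := by
      apply K.diag (C := s) (D := ax b)
      · rw [← cr_cyc]; exact hc
      · have : cr t (ax l) (ax b) = (b - l) * t.2 := by simp [cr]; ring
        rw [this]; exact mul_neg_of_neg_of_pos (by linarith) ht
      · exact hst.symm
      · exact lv.symm
      · exact hbl'.symm
      · exact htb.symm
    have e : cr (ax l) s t - cr (ax b) s t = (l - b) * (s.2 - t.2) := by simp [cr]; ring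
    have hlow : 0 < s.2 - t.2 := by
      have : 0 < (l - b) * (s.2 - t.2) := by linarith
      exact (mul_pos_iff_of_pos_left (by linarith)).1 this
    set θ := s.2 / (s.2 - t.2) with hθ
    have hθ1 : 1 ≤ θ := by rw [hθ, le_div_iff₀ hlow]; linarith
    set x := ln s t θ with hx
    have x2 : x.2 = 0 := by simp [hx, hθ]; field_simp; ring
    have xe : x = ax x.1 := Prod.ext rfl x2
    have c1 : cr (ax l) s x = θ * cr (ax l) s t := by
      rw [hx, cr_ln]; simp [cr]; ring
    have c2 : cr (ax b) s x = θ * cr (ax b) s t := by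
      rw [hx, cr_ln]; simp [cr]; ring
    have c1' : cr (ax l) s x = s.2 * (l - x.1) := by simp only [cr, x2]; simp; ring
    have c2' : cr (ax b) s x = s.2 * (b - x.1) := by simp only [cr, x2]; simp; ring
    have hθ0 : 0 < θ := by linarith
    have xl : x.1 < l := by
      have : 0 < s.2 * (l - x.1) := by rw [← c1', c1]; positivity
      have := (mul_pos_iff_of_pos_left hs).1 this; linarith
    have xb : b < x.1 := by
      have h1 : s.2 * (b - x.1) < 0 := by rw [← c2', c2]; exact mul_neg_of_pos_of_neg hθ0 h
      by_contra hcon; push Not at hcon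
      have : 0 ≤ s.2 * (b - x.1) := mul_nonneg hs.le (by linarith)
      linarith
    have vtx : Vis P t x := by
      apply K.vis_tri htb hbl' vtl.symm (tri_a _ _ _)
      rw [xe]
      exact tri_seg (tri_b _ _ _) (tri_c _ _ _) (ax_seg xb.le xl.le)
    have vsx : Vis P s x := by
      have := vis_glue (A := s) (B := t) (s := 0) (r := 1) (t := θ) (P := P) (by simpa using hst)
        (by simpa using vtx) zero_le_one hθ1
      simpa using this
    rw [xe] at vsx
    have := lm x.1 (by linarith) (by linarith) vsx.symm
    linarith
  · have h' : cr (ax b) t s = 0 := by rw [cr_swap', h]; simp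
    have e := coll_ln h' (by simpa using ht.ne')
    simp only [ax_snd, sub_zero] at e
    have hτ : 0 < s.2 / t.2 := by positivity
    apply nb
    rw [e]
    rcases le_total (s.2 / t.2) 1 with h1 | h1
    · exact htb.symm.subl (ln_mem_seg hτ.le h1)
    · have := vis_glue (A := ax b) (B := t) (s := 0) (r := 1) (t := s.2 / t.2) (P := P) (by simpa using htb.symm)
        (by rw [← e]; simpa using hst.symm) zero_le_one h1
      simpa using this
  · apply nb
    apply Vis.symm
    apply K.diag (C := ax l) (D := t)
    · have : cr s (ax b) (ax l) = (l - b) * s.2 := by simp [cr]; ring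
      rw [this]; exact mul_pos (by linarith) hs
    · rw [cr_swap]; linarith
    · exact lv.symm
    · exact hbl'.symm
    · exact htb.symm
    · exact hst.symm

lemma Core.lemS (K : Core P N u w) {p k : ℝ × ℝ} {a τ : ℝ} (hp : 0 < p.2) (ha : IsL P u w p a)
    (hτ : 1 < τ) (hr : Vis P p (ln (ax a) p τ)) (hk : Vis P k (ln (ax a) p τ)) (hkp : ¬ Vis P k p) :
    ∃ c, IsL P u w k c ∧ a < c ∧ ∃ τ', 1 < τ' ∧ τ' ≤ τ ∧ ln (ax a) p τ' ∈ segment ℝ k (ax c) := by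
  obtain ⟨a1, a2, av, am⟩ := ha
  set r := ln (ax a) p τ with hrdef
  have var : Vis P (ax a) r := by
    have := vis_glue (A := ax a) (B := p) (s := 0) (r := 1) (t := τ) (P := P) (by simpa using av)
        (by simpa using hr) zero_le_one hτ.le
    simpa using this
  have hline : ∀ δ, 0 ≤ δ → δ ≤ τ → ln (ax a) p δ ∈ segment ℝ (ax a) r := by
    intro δ h0 h1
    have := ln_between (A := ax a) (B := p) h0 h1
    simpa using this
  have hpseg : p ∈ segment ℝ (ax a) r := by have := hline 1 zero_le_one hτ.le; simpa using this
  -- seeing `a` and `r` suffices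
  have notka : ¬ Vis P k (ax a) := by
    intro h
    exact hkp (K.vis_tri hk var.symm h.symm (tri_a _ _ _) (tri_seg (tri_c _ _ _) (tri_b _ _ _) hpseg))
  have notd : ∀ δ, 0 ≤ δ → δ ≤ 1 → ¬ Vis P k (ln (ax a) p δ) := by
    intro δ h0 h1 h
    have v2 : Vis P r (ln (ax a) p δ) := (var.subr (hline δ h0 (by linarith))).symm
    refine hkp (K.vis_tri hk v2 h.symm (tri_a _ _ _) (tri_seg (tri_c _ _ _) (tri_b _ _ _) ?_))
    have := ln_between (A := ax a) (B := p) h1 hτ.le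
    simpa using this
  have notpc : ∀ c, u ≤ c → c < a → ¬ Vis P p (ax c) := fun c h1 h2 h => by
    have := am c h1 (by linarith) h.symm; linarith
  have hkP := hk.left
  obtain ⟨c, hc⟩ := K.exists_L hkP
  refine ⟨c, hc, ?_⟩
  obtain ⟨c1, c2, cv, cm⟩ := hc
  have vca := K.vis_ax c1 c2 a1 a2
  have hk0 : 0 < k.2 := by
    rcases eq_or_lt_of_le (K.half k hkP) with h | h
    · exact absurd (K.vis_low hkP h.symm a1 a2) notka
    · exact h
  have hca : c ≠ a := by rintro rfl; exact notka cv.symm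
  have r2 : r.2 = τ * p.2 := by simp [hrdef]
  have hr0 : 0 < r.2 := by rw [r2]; positivity
  have crk : cr k (ax a) r = τ * cr (ax a) p k := by simp [cr, hrdef]; ring
  have cck : cr k (ax a) (ax c) = (c - a) * k.2 := by simp [cr]; ring
  have cpc : cr (ax a) p (ax c) = p.2 * (a - c) := by simp [cr]; ring
  have hτ0 : 0 < τ := by linarith
  rcases lt_trichotomy (cr (ax a) p k) 0 with h | h | h
  · exfalso
    rcases lt_or_gt_of_ne hca with hlt | hgt
    · -- c < a
      obtain ⟨d, hd, hd0⟩ := crossing (A := ax a) (B := p) (X := ax c) (Y := k)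
        (by rw [cpc]; exact mul_nonneg hp.le (by linarith)) h.le
      have e := coll_ln hd0 (by simpa using hp.ne')
      simp only [ax_snd, sub_zero] at e
      set δ := d.2 / p.2 with hδ
      have hdP := cv hd
      have hδ0 : 0 ≤ δ := div_nonneg (K.half d hdP) hp.le
      rcases le_or_gt δ 1 with h1 | h1
      · apply notd δ hδ0 h1; rw [← e]; exact (cv.subr hd).symm
      rcases le_or_gt δ τ with h2 | h2
      · apply notpc c c1 hlt
        have vad : Vis P (ax a) d := by rw [e]; exact var.subl (hline δ hδ0 h2)
        refine K.vis_tri (cv.subl hd).symm vca vad (tri_seg (tri_c _ _ _) (tri_a _ _ _) ?_) (tri_b _ _ _)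
        rw [e]
        have := ln_between (A := ax a) (B := p) zero_le_one h1.le
        simpa using this
      · have vrc : Vis P r (ax c) := by
          apply K.diag (C := ax a) (D := k)
          · have : cr r (ax c) (ax a) = (a - c) * r.2 := by simp [cr]; ring
            rw [this]; exact mul_pos (by linarith) hr0
          · obtain ⟨θ, t0, t1, hθ⟩ := seg_ln hd
            have e1 : cr r (ax c) d = θ * cr r (ax c) k := by
              rw [hθ, cr_ln]; simp [cr]; ring
            have e2 : cr r (ax c) d = (τ - δ) * p.2 * (a - c) := by
              rw [e]; simp [cr, hrdef]; ring
            have e3 : (τ - δ) * p.2 * (a - c) < 0 :=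
              mul_neg_of_neg_of_pos (mul_neg_of_neg_of_pos (by linarith) hp) (by linarith)
            rw [← e2, e1] at e3
            by_contra hcon; push Not at hcon
            have := mul_nonneg t0 hcon
            linarith
          · exact var.symm
          · exact vca.symm
          · exact cv
          · exact hk
        apply notpc c c1 hlt
        exact K.vis_tri vrc vca var (tri_seg (tri_c _ _ _) (tri_a _ _ _) hpseg) (tri_b _ _ _)
    · apply notka
      apply K.diag (C := ax c) (D := r)
      · rw [cck]; exact mul_pos (by linarith) hk0
      · rw [crk]; exact mul_neg_of_pos_of_neg hτ0 h
      · exact cv.symm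
      · exact vca
      · exact var
      · exact hk.symm
  · exfalso
    have e := coll_ln h (by simpa using hp.ne')
    simp only [ax_snd, sub_zero] at e
    set κ := k.2 / p.2 with hκ
    have hκ0 : 0 < κ := by positivity
    rcases le_or_gt κ τ with h1 | h1
    · apply hkp; rw [e]
      exact var.sub (hline κ hκ0.le h1) hpseg
    · apply hkp
      apply Vis.symm
      have := vis_glue (A := ax a) (B := p) (s := 1) (r := τ) (t := κ) (P := P) (by simpa using hr)
        (by rw [← e]; exact hk.symm) hτ.le h1.le
      rw [← e] at this; simpa using this
  · rcases lt_or_gt_of_ne hca with hlt | hgt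
    · exfalso
      apply notka
      apply K.diag (C := r) (D := ax c)
      · rw [crk]; positivity
      · rw [cck]; exact mul_neg_of_neg_of_pos (by linarith) hk0
      · exact hk
      · exact var.symm
      · exact vca.symm
      · exact cv
    · refine ⟨hgt, ?_⟩
      obtain ⟨d, hd, hd0⟩ := crossing (A := ax a) (B := p) (X := k) (Y := ax c) h.le
        (by rw [cpc]; exact mul_nonpos_of_nonneg_of_nonpos hp.le (by linarith))
      have e := coll_ln hd0 (by simpa using hp.ne')
      simp only [ax_snd, sub_zero] at e
      set δ := d.2 / p.2 with hδ
      have hdP := cv.symm hd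
      have hδ0 : 0 ≤ δ := div_nonneg (K.half d hdP) hp.le
      rcases le_or_gt δ 1 with h1 | h1
      · exfalso
        apply notd δ hδ0 h1; rw [← e]; exact cv.symm.subl hd
      rcases le_or_gt δ τ with h2 | h2
      · exact ⟨δ, h1, h2, e ▸ hd⟩
      · exfalso
        have := K.lemL hk0 hr0 hk a1 var.symm ⟨c1, c2, cv, cm⟩ hgt
        have h3 : cr (ax c) k d = 0 := by
          obtain ⟨θ, t0, t1, hθ⟩ := seg_ln hd
          rw [hθ, cr_ln]; simp [cr]; ring
        have h4 : cr (ax c) k (ax a) = k.2 * (c - a) := by simp [cr]; ring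
        have h5 : δ * cr (ax c) k r = (δ - τ) * cr (ax c) k (ax a) + τ * cr (ax c) k d := by
          rw [e]; simp [cr, hrdef]; ring
        rw [h3, h4] at h5
        have : 0 < (δ - τ) * (k.2 * (c - a)) := mul_pos (by linarith) (mul_pos hk0 (by linarith))
        have : δ * cr (ax c) k r ≤ 0 := mul_nonpos_of_nonneg_of_nonpos hδ0 (by linarith)
        linarith

end WV


namespace WV

variable {P N : Set (ℝ × ℝ)} {u w : ℝ}

def Blk (P : Set (ℝ × ℝ)) (s : ℝ × ℝ) (l : ℝ) (z : ℝ × ℝ) : Prop :=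
  z ∈ segment ℝ s (ax l) ∧ ∀ ε > 0, ∃ h, h ∉ P ∧ dist h z < ε ∧ 0 ≤ h.2 ∧ 0 < cr (ax l) s h

def Low (P : Set (ℝ × ℝ)) (s : ℝ × ℝ) (l : ℝ) (z : ℝ × ℝ) : Prop :=
  Blk P s l z ∧ ∀ z', Blk P s l z' → z.2 ≤ z'.2

lemma seg_param {s z : ℝ × ℝ} {l : ℝ} (h : z ∈ segment ℝ s (ax l)) :
    ∃ ζ, 0 ≤ ζ ∧ ζ ≤ 1 ∧ z = ln (ax l) s ζ := by
  rw [segment_symm] at h; exact mem_seg_ln.1 h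

lemma param_seg {s : ℝ × ℝ} {l ζ : ℝ} (h0 : 0 ≤ ζ) (h1 : ζ ≤ 1) : ln (ax l) s ζ ∈ segment ℝ s (ax l) := by
  rw [segment_symm]; exact ln_mem_seg h0 h1

lemma Low.unique {s z z' : ℝ × ℝ} {l : ℝ} (hs : 0 < s.2) (h : Low P s l z) (h' : Low P s l z') : z = z' := by
  have e := le_antisymm (h.2 _ h'.1) (h'.2 _ h.1)
  obtain ⟨ζ, -, -, rfl⟩ := seg_param h.1.1
  obtain ⟨ζ', -, -, rfl⟩ := seg_param h'.1.1
  simp at e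
  rcases e with e | e
  · rw [e]
  · exact absurd e hs.ne'

lemma nhd_pos {A B z : ℝ × ℝ} (h : 0 < cr A B z) : ∃ ε > 0, ∀ q, dist q z < ε → 0 < cr A B q := by
  obtain ⟨ε, hε, hb⟩ := Metric.isOpen_iff.1 (isOpen_cr A B) z h
  exact ⟨ε, hε, fun q hq => hb hq⟩

lemma Core.B1 (K : Core P N u w) {s : ℝ × ℝ} {l : ℝ} (hl : IsL P u w s l) (hul : u < l) (hs : 0 < s.2) :
    ∃ z, Blk P s l z ∧ z.2 < s.2 := by
  obtain ⟨l1, l2, lv, lm⟩ := hl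
  obtain ⟨ε, hε, hcone⟩ := K.cone lv.right
  obtain ⟨M, hM0, hM⟩ : ∃ M : ℝ, 0 < M ∧ ∀ c ∈ Set.Icc u l, dist (ax c) s ≤ M := by
    have hc : ContinuousOn (fun c => dist (ax c) s) (Set.Icc u l) := by
      unfold ax; fun_prop
    obtain ⟨M, hM⟩ := isCompact_Icc.bddAbove_image hc
    refine ⟨max M 1, by positivity, fun c hcm => le_max_of_le_left (hM ⟨c, hcm, rfl⟩)⟩
  set δ := min (1/2) (ε / (2 * M)) with hδ
  have hδ0 : 0 < δ := lt_min (by norm_num) (by positivity)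
  have hδ1 : δ ≤ 1 := (min_le_left _ _).trans (by norm_num)
  have hln : ∀ c θ, ln s (ax c) θ = s + θ • (ax c - s) := by
    intro c θ; ext <;> simp [ln]
  have hball : ∀ c ∈ Set.Icc u l, ln s (ax c) δ ∈ Metric.ball s ε := by
    intro c hc
    rw [Metric.mem_ball, hln, dist_eq_norm, add_sub_cancel_left, norm_smul, Real.norm_of_nonneg hδ0.le,
      ← dist_eq_norm]
    have h1 : δ * dist (ax c) s ≤ δ * M := mul_le_mul_of_nonneg_left (hM c hc) hδ0.le
    have h2 : δ * M ≤ ε / (2 * M) * M := mul_le_mul_of_nonneg_right (min_le_right _ _) hM0.le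
    have h3 : ε / (2 * M) * M = ε / 2 := by field_simp
    linarith
  have key : ∀ c, u ≤ c → c < l → ∃ θ ∈ Set.Icc δ 1, ln s (ax c) θ ∉ P := by
    intro c hc1 hc2
    have nv : ¬ Vis P s (ax c) := fun h => by have := lm c hc1 (by linarith) h.symm; linarith
    unfold Vis at nv
    rw [Set.not_subset] at nv
    obtain ⟨q, hq, hqP⟩ := nv
    obtain ⟨θ, t0, t1, rfl⟩ := mem_seg_ln.1 hq
    rcases le_total δ θ with h | h
    · exact ⟨θ, ⟨h, t1⟩, hqP⟩
    · refine ⟨δ, ⟨le_rfl, hδ1⟩, fun hin => hqP ?_⟩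
      rcases eq_or_lt_of_le t0 with e | e
      · rw [← e, ln_zero]; exact lv.right
      · have := (hcone _ (hball c ⟨hc1, hc2.le⟩) (θ / δ) (by positivity) (by rw [div_le_one hδ0]; exact h)).2 hin
        convert this using 1
        rw [hln, hln, add_sub_cancel_left, smul_smul, div_mul_cancel₀ _ hδ0.ne']
  have hcn : ∀ n : ℕ, ∃ θ ∈ Set.Icc δ 1, ln s (ax (l - (l - u) / (n + 1))) θ ∉ P := by
    intro n
    have hn : (0:ℝ) < n + 1 := by positivity
    have h1 : (l - u) / (n + 1) ≤ l - u := by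
      rw [div_le_iff₀ hn]; nlinarith [show (0:ℝ) ≤ n from Nat.cast_nonneg n]
    have h2 : 0 < (l - u) / (n + 1) := div_pos (by linarith) hn
    exact key _ (by linarith) (by linarith)
  choose θ hθ hθP using hcn
  obtain ⟨t, ht, φ, hφ, hlim⟩ := isCompact_Icc.tendsto_subseq hθ
  refine ⟨ln s (ax l) t, ⟨ln_mem_seg (by linarith [ht.1]) ht.2, ?_⟩, ?_⟩
  · intro η hη
    have hc0 : Filter.Tendsto (fun n : ℕ => l - (l - u) / ((n:ℝ) + 1)) Filter.atTop (nhds l) := by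
      have := tendsto_const_div_atTop_nhds_zero_nat (l - u)
      have := (this.comp (Filter.tendsto_add_atTop_nat 1)).const_sub l
      simpa using this
    have hc1 := hc0.comp hφ.tendsto_atTop
    have hcont : Continuous (fun x : ℝ × ℝ => ln s (ax x.1) x.2) := by unfold ln ax; fun_prop
    have h2 := (hcont.tendsto (l, t)).comp (hc1.prodMk_nhds hlim)
    obtain ⟨n, hn⟩ := ((Metric.tendsto_nhds.1 h2) η hη).exists
    refine ⟨_, hθP (φ n), hn, ?_, ?_⟩
    · simp
      have := (hθ (φ n)).2
      nlinarith
    · rw [cr_ln]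
      have e1 : cr (ax l) s s = 0 := by simp [cr]; ring
      have e2 : ∀ c, cr (ax l) s (ax c) = s.2 * (l - c) := by intro c; simp [cr]; ring
      rw [e1, e2]
      have : 0 < θ (φ n) := by linarith [(hθ (φ n)).1]
      have : (0:ℝ) < (l - u) / (((φ n : ℕ) : ℝ) + 1) := div_pos (by linarith) (by positivity)
      have : 0 < θ (φ n) * (s.2 * (l - (l - (l - u) / (((φ n : ℕ) : ℝ) + 1)))) := by
        rw [sub_sub_cancel]; positivity
      linarith
  · simp; nlinarith [ht.1]

lemma Core.B2 (K : Core P N u w) {s : ℝ × ℝ} {l : ℝ} (hl : IsL P u w s l) (hul : u < l) (hs : 0 < s.2) :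
    ∃ z, Low P s l z ∧ z.2 < s.2 := by
  obtain ⟨z0, hz0, hz0s⟩ := K.B1 hl hul hs
  have hcl : IsClosed {z | ∀ ε > 0, ∃ h, h ∉ P ∧ dist h z < ε ∧ 0 ≤ h.2 ∧ 0 < cr (ax l) s h} := by
    rw [← closure_subset_iff_isClosed]
    intro z hz ε hε
    obtain ⟨z', hz', hd⟩ := Metric.mem_closure_iff.1 hz (ε / 2) (by linarith)
    obtain ⟨h, h1, h2, h3⟩ := hz' (ε / 2) (by linarith)
    refine ⟨h, h1, ?_, h3⟩
    have := dist_triangle h z' z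
    rw [dist_comm z z'] at hd
    linarith
  have hseg : IsCompact (segment ℝ s (ax l)) := by
    rw [← convexHull_pair]
    exact Set.Finite.isCompact_convexHull ℝ (by simp)
  have hcpt : IsCompact {z | Blk P s l z} := hseg.inter_right hcl
  obtain ⟨z, hz, hmin⟩ := hcpt.exists_isMinOn ⟨z0, hz0⟩ (continuous_snd.continuousOn (s := {z | Blk P s l z}))
  refine ⟨z, ⟨hz, fun z' hz' => hmin hz'⟩, lt_of_le_of_lt (hmin hz0) hz0s⟩

lemma B3a {s z m : ℝ × ℝ} {a l : ℝ} (hs : 0 < s.2) (hz : Blk P s l z) (hm : m ∈ segment ℝ s (ax l)) (hal : a < l)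
    (hT : Tri (ax a) (ax l) m ⊆ P) : m.2 ≤ z.2 := by
  by_contra hc
  push Not at hc
  obtain ⟨hzs, hzb⟩ := hz
  obtain ⟨ζ, z0, z1, rfl⟩ := seg_param hzs
  obtain ⟨μ, m0, m1, rfl⟩ := seg_param hm
  simp at hc
  have hμ : ζ < μ := lt_of_mul_lt_mul_right hc hs.le
  have hμ0 : 0 < μ := by linarith
  have e1 : cr (ln (ax l) s μ) (ax a) (ln (ax l) s ζ) = (μ - ζ) * (s.2 * (l - a)) := by
    simp [cr]; ring
  obtain ⟨ε, hε, hb⟩ := nhd_pos (A := ln (ax l) s μ) (B := ax a) (z := ln (ax l) s ζ)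
    (by rw [e1]; exact mul_pos (by linarith) (mul_pos hs (by linarith)))
  obtain ⟨h, h1, h2, h3, h4⟩ := hzb ε hε
  apply h1
  apply hT
  apply tri_of_cr
  · have : cr (ax a) (ax l) (ln (ax l) s μ) = (l - a) * (μ * s.2) := by simp [cr]
    rw [this]; exact mul_pos (by linarith) (by positivity)
  · have : cr (ax a) (ax l) h = (l - a) * h.2 := by simp [cr]
    rw [this]; exact mul_nonneg (by linarith) h3
  · have : cr (ax l) (ln (ax l) s μ) h = μ * cr (ax l) s h := by simp [cr]; ring
    rw [this]; positivity
  · exact (hb h h2).le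

lemma B3b {s x y z q : ℝ × ℝ} {l : ℝ} (hs : 0 < s.2) (hx : x ∈ segment ℝ s (ax l)) (hy : y ∈ segment ℝ s (ax l))
    (hxz : z.2 < x.2) (hyz : y.2 < z.2) (hq : 0 < cr (ax l) s q) (hT : Tri y x q ⊆ P) : ¬ Blk P s l z := by
  rintro ⟨hzs, hzb⟩
  obtain ⟨ζ, z0, z1, rfl⟩ := seg_param hzs
  obtain ⟨ξ, x0, x1, rfl⟩ := seg_param hx
  obtain ⟨η, y0, y1, rfl⟩ := seg_param hy
  simp at hxz hyz
  have h1 : ζ < ξ := lt_of_mul_lt_mul_right hxz hs.le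
  have h2 : η < ζ := lt_of_mul_lt_mul_right hyz hs.le
  have e1 : cr (ln (ax l) s ξ) q (ln (ax l) s ζ) = (ξ - ζ) * cr (ax l) s q := by
    simp [cr]; ring
  have e2 : cr q (ln (ax l) s η) (ln (ax l) s ζ) = (ζ - η) * cr (ax l) s q := by
    simp [cr]; ring
  have e3 : ∀ h, cr (ln (ax l) s η) (ln (ax l) s ξ) h = (ξ - η) * cr (ax l) s h := by
    intro h; simp [cr]; ring
  obtain ⟨ε, hε, hb⟩ := nhd_pos (A := ln (ax l) s ξ) (B := q) (z := ln (ax l) s ζ)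
    (by rw [e1]; exact mul_pos (by linarith) hq)
  obtain ⟨ε', hε', hb'⟩ := nhd_pos (A := q) (B := ln (ax l) s η) (z := ln (ax l) s ζ)
    (by rw [e2]; exact mul_pos (by linarith) hq)
  obtain ⟨h, i1, i2, i3, i4⟩ := hzb (min ε ε') (lt_min hε hε')
  apply i1
  apply hT
  apply tri_of_cr
  · rw [e3]; exact mul_pos (by linarith) hq
  · rw [e3]; exact mul_nonneg (by linarith) i4.le
  · exact (hb h (lt_of_lt_of_le i2 (min_le_left _ _))).le
  · exact (hb' h (lt_of_lt_of_le i2 (min_le_right _ _))).le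

lemma Core.B4 (K : Core P N u w) {s z : ℝ × ℝ} {l : ℝ} (hv : Vis P s (ax l)) (hz : Low P s l z) (hz0 : 0 < z.2)
    (hzs : z.2 < s.2) : z ∈ N := by
  by_contra hN
  obtain ⟨⟨hzseg, hzb⟩, hmin⟩ := hz
  have hs : 0 < s.2 := by linarith
  have hzP := hv hzseg
  have hzf : z ∈ frontier P := by
    refine ⟨subset_closure hzP, fun hi => ?_⟩
    obtain ⟨ε, hε, hb⟩ := Metric.isOpen_iff.1 isOpen_interior z hi
    obtain ⟨h, h1, h2, -⟩ := hzb ε hε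
    exact h1 (interior_subset (hb h2))
  obtain ⟨ε, hε, d, d2, hd, -, hf, -, hd2⟩ := K.loc z hzf
  have hd2 := hd2 hN
  let D : ℝ × ℝ → ℝ := fun q => d.1 * (q.2 - z.2) - d.2 * (q.1 - z.1)
  have hD : ∀ q ∈ Metric.ball z ε, q ∈ frontier P → D q = 0 := by
    intro q hq hqf
    obtain ⟨t, -, rfl | rfl⟩ := (hf q hq).1 hqf
    · simp [D]; ring
    · simp [D, hd2]; ring
  have hD' : ∀ q ∈ Metric.ball z ε, D q = 0 → q ∈ frontier P := by
    intro q hq hq0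
    rw [hf q hq]
    have hs : ∃ t : ℝ, q = z + t • d := by
      simp only [D] at hq0
      by_cases hdd : d.1 = 0
      · have hd2 : d.2 ≠ 0 := fun h => hd (Prod.ext hdd h)
        refine ⟨(q.2 - z.2) / d.2, ?_⟩
        have : q.1 = z.1 := by
          rw [hdd] at hq0
          have : d.2 * (q.1 - z.1) = 0 := by linarith
          have := (mul_eq_zero.1 this).resolve_left hd2
          linarith
        ext
        · simp [hdd, this]
        · simp; field_simp; ring
      · refine ⟨(q.1 - z.1) / d.1, ?_⟩
        ext
        · simp; field_simp; ring
        · simp; field_simp; linarith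
    obtain ⟨t, rfl⟩ := hs
    rcases le_total 0 t with h | h
    · exact ⟨t, h, Or.inl rfl⟩
    · exact ⟨-t, by linarith, Or.inr (by rw [hd2, neg_smul_neg])⟩
  have c1' : Convex ℝ {q | 0 < D q} := by
    convert convex_pos (-d.2) d.1 (d.2 * z.1 - d.1 * z.2) using 4
    simp only [D]; ring
  have c2' : Convex ℝ {q | D q < 0} := by
    convert convex_neg (-d.2) d.1 (d.2 * z.1 - d.1 * z.2) using 4
    simp only [D]; ring
  have c1 : Convex ℝ (Metric.ball z ε ∩ {q | 0 < D q}) := (convex_ball _ _).inter c1'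
  have c2 : Convex ℝ (Metric.ball z ε ∩ {q | D q < 0}) := (convex_ball _ _).inter c2'
  have r1 := dichot (P := P) c1.isPreconnected (fun q hq hqf => (ne_of_gt hq.2) (hD q hq.1 hqf))
  have r2 := dichot (P := P) c2.isPreconnected (fun q hq hqf => (ne_of_lt hq.2) (hD q hq.1 hqf))
  obtain ⟨ζ, z0, z1, hze⟩ := seg_param hzseg
  have hz2 : z.2 = ζ * s.2 := by rw [hze]; simp
  have hζ0 : 0 < ζ := by rw [hz2] at hz0; exact (pos_iff_pos_of_mul_pos hz0).2 hs
  have hζ1 : ζ < 1 := by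
    by_contra h; push Not at h
    nlinarith
  -- points near z on the line
  have near : ∃ η > 0, η < ζ ∧ η < 1 - ζ ∧ ln (ax l) s (ζ + η) ∈ Metric.ball z ε ∧
      ln (ax l) s (ζ - η) ∈ Metric.ball z ε := by
    have hcont : Continuous (fun x : ℝ => ln (ax l) s x) := by unfold ln; fun_prop
    obtain ⟨η, hη, hb⟩ := Metric.continuous_iff.1 hcont ζ ε hε
    refine ⟨min (η / 2) (min (ζ / 2) ((1 - ζ) / 2)), ?_, ?_, ?_, ?_, ?_⟩
    · refine lt_min (by linarith) (lt_min (by linarith) (by linarith))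
    · exact lt_of_le_of_lt ((min_le_right _ _).trans (min_le_left _ _)) (by linarith)
    · exact lt_of_le_of_lt ((min_le_right _ _).trans (min_le_right _ _)) (by linarith)
    · rw [Metric.mem_ball]
      conv_rhs => rw [← sub_zero ε]
      rw [hze, sub_zero]
      apply hb
      rw [Real.dist_eq, add_sub_cancel_left, abs_of_pos]
      · exact lt_of_le_of_lt (min_le_left _ _) (by linarith)
      · refine lt_min (by linarith) (lt_min (by linarith) (by linarith))
    · rw [Metric.mem_ball]
      conv_rhs => rw [← sub_zero ε]
      rw [hze, sub_zero]
      apply hb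
      rw [Real.dist_eq, sub_sub_cancel_left, abs_neg, abs_of_pos]
      · exact lt_of_le_of_lt (min_le_left _ _) (by linarith)
      · refine lt_min (by linarith) (lt_min (by linarith) (by linarith))
  obtain ⟨η, hη0, hη1, hη2, nb1, nb2⟩ := near
  have hDl : ∀ ξ, D (ln (ax l) s ξ) = (ξ - ζ) * (d.1 * s.2 - d.2 * (s.1 - l)) := by
    intro ξ; simp [D, hze]; ring
  have pP : ∀ ξ, 0 ≤ ξ → ξ ≤ 1 → ln (ax l) s ξ ∈ P := fun ξ h0 h1 => hv (param_seg h0 h1)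
  have q1 := pP (ζ + η) (by linarith) (by linarith)
  have q2 := pP (ζ - η) (by linarith) (by linarith)
  obtain ⟨h, hh1, hh2, hh3, hh4⟩ := hzb ε hε
  by_cases hσ : d.1 * s.2 - d.2 * (s.1 - l) = 0
  · -- parallel
    have par : ∃ κ : ℝ, κ ≠ 0 ∧ ∀ q, D q = κ * cr (ax l) s q := by
      refine ⟨d.2 / s.2, ?_, ?_⟩
      · intro h0
        have hd2' : d.2 = 0 := by
          rcases div_eq_zero_iff.1 h0 with h | h
          · exact h
          · exact absurd h hs.ne'
        rw [hd2'] at hσ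
        have : d.1 = 0 := by
          have : d.1 * s.2 = 0 := by linarith
          exact (mul_eq_zero.1 this).resolve_right hs.ne'
        exact hd (Prod.ext this hd2')
      · intro q
        have hd1 : d.1 = d.2 * (s.1 - l) / s.2 := by field_simp; linarith
        simp only [D, cr, hze, hd1]
        simp
        field_simp
        ring
    obtain ⟨κ, hκ, hpar⟩ := par
    have left : ∀ q ∈ Metric.ball z ε, 0 < cr (ax l) s q → q ∉ P := by
      intro q hq hqc hqP
      rcases lt_or_gt_of_ne hκ with hk | hk
      · have m1 : q ∈ Metric.ball z ε ∩ {q | D q < 0} := ⟨hq, by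
          simp only [Set.mem_ofPred_eq]; rw [hpar]; exact mul_neg_of_neg_of_pos hk hqc⟩
        have m2 : h ∈ Metric.ball z ε ∩ {q | D q < 0} := ⟨hh2, by
          simp only [Set.mem_ofPred_eq]; rw [hpar]; exact mul_neg_of_neg_of_pos hk hh4⟩
        rcases r2 with r | r
        · exact hh1 (r m2)
        · exact r m1 hqP
      · have m1 : q ∈ Metric.ball z ε ∩ {q | 0 < D q} := ⟨hq, by
          simp only [Set.mem_ofPred_eq]; rw [hpar]; positivity⟩
        have m2 : h ∈ Metric.ball z ε ∩ {q | 0 < D q} := ⟨hh2, by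
          simp only [Set.mem_ofPred_eq]; rw [hpar]; positivity⟩
        rcases r1 with r | r
        · exact hh1 (r m2)
        · exact r m1 hqP
    have hb : Blk P s l (ln (ax l) s (ζ - η)) := by
      refine ⟨param_seg (by linarith) (by linarith), ?_⟩
      intro ε' hε'
      obtain ⟨ε'', hε'', hbb⟩ := Metric.isOpen_iff.1 Metric.isOpen_ball _ nb2
      obtain ⟨t, ht, htm⟩ := small_mem (ln (ax l) s (ζ - η)) (-1, 0) (lt_min hε' hε'')
      have hc : 0 < cr (ax l) s (ln (ax l) s (ζ - η) + t • (-1, 0)) := by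
        have : cr (ax l) s (ln (ax l) s (ζ - η) + t • (-1, 0)) = s.2 * t := by simp [cr]; ring
        rw [this]; positivity
      refine ⟨_, left _ (hbb (Metric.ball_subset_ball (min_le_right _ _) htm)) hc,
        lt_of_lt_of_le htm (min_le_left _ _), ?_, hc⟩
      simp
      exact mul_nonneg (by linarith) hs.le
    have := hmin _ hb
    rw [hz2] at this
    simp at this
    nlinarith
  · -- transversal
    have both : (Metric.ball z ε ∩ {q | 0 < D q} ⊆ P) ∧ (Metric.ball z ε ∩ {q | D q < 0} ⊆ P) := by
      have e1 := hDl (ζ + η)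
      have e2 := hDl (ζ - η)
      rw [add_sub_cancel_left] at e1
      rw [sub_sub_cancel_left] at e2
      rcases lt_or_gt_of_ne hσ with hk | hk
      · have m1 : D (ln (ax l) s (ζ + η)) < 0 := by rw [e1]; exact mul_neg_of_pos_of_neg hη0 hk
        have m2 : 0 < D (ln (ax l) s (ζ - η)) := by rw [e2]; exact mul_pos_of_neg_of_neg (by linarith) hk
        exact ⟨r1.resolve_right (fun r => r ⟨nb2, m2⟩ q2), r2.resolve_right (fun r => r ⟨nb1, m1⟩ q1)⟩
      · have m1 : 0 < D (ln (ax l) s (ζ + η)) := by rw [e1]; positivity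
        have m2 : D (ln (ax l) s (ζ - η)) < 0 := by rw [e2]; exact mul_neg_of_neg_of_pos (by linarith) hk
        exact ⟨r1.resolve_right (fun r => r ⟨nb1, m1⟩ q1), r2.resolve_right (fun r => r ⟨nb2, m2⟩ q2)⟩
    apply hh1
    rcases lt_trichotomy (D h) 0 with h0 | h0 | h0
    · exact both.2 ⟨hh2, h0⟩
    · exact K.fr (hD' h hh2 h0)
    · exact both.1 ⟨hh2, h0⟩

lemma Core.B5 (K : Core P N u w) {s z : ℝ × ℝ} {l lam : ℝ} (hl : IsL P u w s l) (hul : u < l) (hz : Low P s l z)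
    (hz0 : 0 < z.2) (hlam : IsL P u w z lam) : lam < l := by
  have hv := hl.2.2.1.symm
  have h1 : lam ≤ l := hlam.2.2.2 l hl.1 hl.2.1 (hv.subr hz.1.1).symm
  refine lt_of_le_of_ne h1 ?_
  rintro rfl
  obtain ⟨z', hz', hlt⟩ := K.B1 hlam hul hz0
  obtain ⟨ζ, b0, b1, e⟩ := seg_param hz.1.1
  have : Blk P s lam z' := by
    refine ⟨seg_sub hz.1.1 (right_mem_segment ℝ _ _) hz'.1, fun ε hε => ?_⟩
    obtain ⟨h, i1, i2, i3, i4⟩ := hz'.2 ε hε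
    refine ⟨h, i1, i2, i3, ?_⟩
    have : cr (ax lam) z h = ζ * cr (ax lam) s h := by rw [e]; simp [cr]; ring
    rw [this] at i4
    by_contra hc
    push Not at hc
    have := mul_nonpos_of_nonneg_of_nonpos b0 hc
    linarith
  have := hz.2 _ this
  linarith

def CC (P : Set (ℝ × ℝ)) (u w : ℝ) (p : ℝ × ℝ) (a : ℝ) (s : ℝ × ℝ) (l : ℝ) : Prop :=
  IsL P u w s l ∧ a < l ∧ ∃ τ, 1 < τ ∧ ln (ax a) p τ ∈ segment ℝ s (ax l) ∧ Vis P p (ln (ax a) p τ)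

lemma Core.Cstep (K : Core P N u w) {p s : ℝ × ℝ} {a l : ℝ} (hp : 0 < p.2) (ha : IsL P u w p a)
    (hC : CC P u w p a s l) : 0 < s.2 ∧ ∃ z ∈ N, Low P s l z ∧ z.2 < s.2 ∧ 0 < z.2 ∧ 0 ≤ cr (ax a) p z ∧
      ∃ lam, IsL P u w z lam ∧ lam < l ∧ (Vis P z p ∨ CC P u w p a z lam) := by
  obtain ⟨hl, hal, τ, hτ, hm, hpm⟩ := hC
  have av := ha.2.2.1
  have hul : u < l := lt_of_le_of_lt ha.1 hal
  obtain ⟨μ, m0, m1, me⟩ := seg_param hm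
  have hm2 : μ * s.2 = τ * p.2 := by
    have := congrArg Prod.snd me; simpa using this.symm
  have hms : 0 < μ * s.2 := by rw [hm2]; positivity
  have hs : 0 < s.2 := by
    by_contra h; push Not at h
    have := mul_nonpos_of_nonneg_of_nonpos m0 h
    linarith
  have hμ : 0 < μ := (pos_iff_pos_of_mul_pos hms).2 hs
  refine ⟨hs, ?_⟩
  obtain ⟨z, hz, hzs⟩ := K.B2 hl hul hs
  have vam : Vis P (ax a) (ln (ax a) p τ) := by
    have := vis_glue (A := ax a) (B := p) (s := 0) (r := 1) (t := τ) (P := P) (by simpa using av)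
        (by simpa using hpm) zero_le_one hτ.le
    simpa using this
  have vl := hl.2.2.1
  have hT : Tri (ax a) (ax l) (ln (ax a) p τ) ⊆ P := by
    refine K.tri (K.vis_ax ha.1 ha.2.1 hl.1 hl.2.1) ?_ vam.symm
    exact (vl.symm.subr hm).symm
  have hmz := B3a hs hz.1 hm hal hT
  have hz0 : 0 < z.2 := lt_of_lt_of_le (by simp; positivity) hmz
  refine ⟨z, K.B4 vl.symm hz hz0 hzs, hz, hzs, hz0, ?_, ?_⟩
  · obtain ⟨ζ, b0, b1, e⟩ := seg_param hz.1.1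
    have hζ : μ ≤ ζ := by
      rw [e, me] at hmz
      simp at hmz
      exact le_of_mul_le_mul_right hmz hs
    have e1 : μ * cr (ax a) p z = (μ - ζ) * cr (ax a) p (ax l) + ζ * cr (ax a) p (ln (ax a) p τ) := by
      rw [me, e, cr_ln, cr_ln]; ring
    have e2 : cr (ax a) p (ln (ax a) p τ) = 0 := by simp [cr]; ring
    have e3 : cr (ax a) p (ax l) = - (p.2 * (l - a)) := by simp [cr]
    rw [e2, e3] at e1
    have : 0 ≤ μ * cr (ax a) p z := by
      rw [e1]
      have : 0 ≤ (ζ - μ) * (p.2 * (l - a)) := mul_nonneg (by linarith) (mul_nonneg hp.le (by linarith))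
      linarith
    exact (mul_nonneg_iff_of_pos_left hμ).1 this
  · obtain ⟨lam, hlam⟩ := K.exists_L (vl.symm hz.1.1)
    refine ⟨lam, hlam, K.B5 hl hul hz hz0 hlam, ?_⟩
    by_cases hv : Vis P z p
    · exact Or.inl hv
    · right
      have vzm : Vis P z (ln (ax a) p τ) := vl.symm.sub hz.1.1 hm
      obtain ⟨c, hc, hac, τ', t1, t2, t3⟩ := K.lemS hp ha hτ hpm vzm hv
      have := hc.unique hlam
      subst this
      refine ⟨hc, hac, τ', t1, t3, ?_⟩
      apply hpm.subl
      have := ln_between (A := ax a) (B := p) t1.le t2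
      simpa using this

end WV


namespace WV

variable {P N : Set (ℝ × ℝ)} {u w : ℝ}

lemma Core.lemN (K : Core P N u w) {p V : ℝ × ℝ} {a l : ℝ} (hp : 0 < p.2) (ha : IsL P u w p a) (hal : a < l)
    (hlw : l ≤ w) (hc : 0 < cr (ax l) V p) (hVp : Vis P V p) (hVl : Vis P V (ax l)) :
    Tri V p (ax l) ⊆ P := by
  have hpl : Vis P p (ax l) := by
    apply K.diag (C := V) (D := ax a)
    · rw [← cr_cyc]; exact hc
    · have : cr p (ax l) (ax a) = (a - l) * p.2 := by simp [cr]; ring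
      rw [this]; exact mul_neg_of_neg_of_pos (by linarith) hp
    · exact hVp.symm
    · exact hVl
    · exact K.vis_ax (by linarith [ha.1]) hlw ha.1 ha.2.1
    · exact ha.2.2.1
  exact K.tri hVp hpl hVl.symm

lemma lemM {p V : ℝ × ℝ} {a l : ℝ} (hp : 0 < p.2) (hal : a < l) (hV : 0 < V.2)
    (hc : 0 < cr (ax l) V p) (hV2 : 0 ≤ cr (ax a) p V) :
    ∃ τ, 1 < τ ∧ ln (ax a) p τ ∈ segment ℝ V (ax l) := by
  obtain ⟨d, hd, hd0⟩ := crossing (A := ax a) (B := p) (X := V) (Y := ax l) hV2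
    (by have : cr (ax a) p (ax l) = p.2 * (a - l) := by simp [cr]; ring
        rw [this]; exact mul_nonpos_of_nonneg_of_nonpos hp.le (by linarith))
  have e := coll_ln hd0 (by simpa using hp.ne')
  simp only [ax_snd, sub_zero] at e
  set δ := d.2 / p.2 with hδ
  refine ⟨δ, ?_, e ▸ hd⟩
  obtain ⟨ν, n0, n1, he⟩ := seg_param hd
  have hd2 : d.2 = ν * V.2 := by rw [he]; simp
  have hδ0 : 0 ≤ δ := by rw [hδ, hd2]; positivity
  have e1 : cr (ax l) V d = 0 := by rw [he]; simp [cr]; ring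
  have e2 : cr (ax l) V d = (1 - δ) * (V.2 * (l - a)) + δ * cr (ax l) V p := by
    rw [e, cr_ln]; simp [cr]; ring
  by_contra hcon
  push Not at hcon
  have h1 : 0 < V.2 * (l - a) := mul_pos hV (by linarith)
  have h2 : 0 ≤ (1 - δ) * (V.2 * (l - a)) := mul_nonneg (by linarith) h1.le
  have h3 : 0 ≤ δ * cr (ax l) V p := mul_nonneg hδ0 hc.le
  have h4 : δ * cr (ax l) V p = 0 := by linarith
  have h5 : δ = 0 := (mul_eq_zero.1 h4).resolve_right hc.ne'
  rw [h5] at e2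
  linarith

lemma Core.step3 (K : Core P N u w) {p V w0 : ℝ × ℝ} {l0 lam : ℝ} (hl0 : IsL P u w w0 l0) (hB : Blk P w0 l0 V)
    (hV0 : 0 < V.2) (hVs : V.2 < w0.2) (hVL : IsL P u w V lam) (hlam : lam < l0)
    (hT : Tri V p (ax l0) ⊆ P) (hp : 0 < cr (ax l0) w0 p) :
    ∃ W l ν, W ∈ frontier P ∧ IsL P u w W l ∧ l0 ≤ l ∧ 0 < ν ∧ ν < 1 ∧ V = ln (ax l) W ν ∧ Blk P W l V ∧
      0 < cr (ax l) W p ∧ ∀ k, Vis P k W → cr (ax l) W k ≤ 0 := by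
  have hw0v := hl0.2.2.1.symm
  have hVP : V ∈ P := hw0v hB.1
  have hw00 : 0 < w0.2 := by linarith
  obtain ⟨ε1, hε1, hcone1⟩ := K.cone hVP
  set ε := min ε1 V.2 with hεdef
  have hε : 0 < ε := lt_min hε1 hV0
  have hcone : ∀ h ∈ Metric.ball V ε, ∀ t : ℝ, 0 < t → t ≤ 1 → (ln V h t ∈ P ↔ h ∈ P) := by
    intro h hh t t0 t1
    have := hcone1 h (Metric.ball_subset_ball (min_le_left _ _) hh) t t0 t1
    have e : ln V h t = V + t • (h - V) := by ext <;> simp [ln]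
    rwa [e]
  have hball2 : ∀ q ∈ Metric.ball V ε, 0 < q.2 := by
    intro q hq
    rw [Metric.mem_ball, Prod.dist_eq, max_lt_iff, Real.dist_eq, Real.dist_eq] at hq
    have h1 := (abs_lt.1 hq.2).1
    have h2 : ε ≤ V.2 := min_le_right _ _
    linarith
  obtain ⟨h, hhP, hhb, -, hhc⟩ := hB.2 ε hε
  have hhb : h ∈ Metric.ball V ε := hhb
  obtain ⟨ζ, z0, z1, hVe⟩ := seg_param hB.1
  have hV2 : V.2 = ζ * w0.2 := by rw [hVe]; simp
  have hζ1 : ζ < 1 := by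
    by_contra hc; push Not at hc; nlinarith
  have hζ0 : 0 < ζ := by
    rw [hV2] at hV0
    exact (pos_iff_pos_of_mul_pos hV0).2 hw00
  -- w0'
  obtain ⟨t, ht, htb⟩ : ∃ t, 0 < t ∧ t ≤ 1 ∧ ln V w0 t ∈ Metric.ball V ε := by
    obtain ⟨t, ht, htb⟩ := small_mem V (w0 - V) hε
    have e : ∀ t, ln V w0 t = V + t • (w0 - V) := by intro t; ext <;> simp [ln]
    refine ⟨min t 1, lt_min ht one_pos, min_le_right _ _, ?_⟩
    have h2 : ln V w0 (min t 1) ∈ segment ℝ (ln V w0 0) (ln V w0 t) :=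
      ln_between (le_min ht.le zero_le_one) (min_le_left _ _)
    rw [ln_zero] at h2
    exact (convex_ball V ε).segment_subset (Metric.mem_ball_self hε) (by rw [e]; exact htb) h2
  obtain ⟨ht1, htb⟩ := htb
  set w1 := ln V w0 t with hw1
  have hw1P : w1 ∈ P := (hw0v.subl hB.1).symm (ln_mem_seg ht.le ht1)
  -- signed position relative to the line
  have xq : ∀ q, cr V w0 q = (1 - ζ) * cr (ax l0) w0 q := by intro q; rw [hVe]; simp [cr]; ring
  have xh : 0 < cr V w0 h := by rw [xq]; exact mul_pos (by linarith) hhc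
  have xp : 0 < cr V w0 p := by rw [xq]; exact mul_pos (by linarith) hp
  -- last point
  obtain ⟨θ, ⟨⟨t0, t1⟩, hWP⟩, hmax⟩ : ∃ θ, θ ∈ Set.Icc (0:ℝ) 1 ∩ {θ | ln w1 h θ ∈ P} ∧
      ∀ θ' ∈ Set.Icc (0:ℝ) 1 ∩ {θ | ln w1 h θ ∈ P}, θ' ≤ θ := by
    have hc : IsCompact (Set.Icc (0:ℝ) 1 ∩ {θ | ln w1 h θ ∈ P}) := by
      apply isCompact_Icc.inter_right
      apply K.closed.preimage
      unfold ln; fun_prop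
    obtain ⟨θ, h1, h2⟩ := hc.exists_isGreatest ⟨0, ⟨le_rfl, zero_le_one⟩, by simpa using hw1P⟩
    exact ⟨θ, h1, fun θ' h => h2 h⟩
  have hθ1 : θ < 1 := by
    refine lt_of_le_of_ne t1 ?_
    rintro rfl
    apply hhP
    simpa using hWP
  set W := ln w1 h θ with hW
  have hWP : W ∈ P := hWP
  have hWb : W ∈ Metric.ball V ε := (convex_ball V ε).segment_subset htb hhb (ln_mem_seg t0 t1)
  have out : ∀ s, 0 < s → s ≤ 1 → ln W h s ∉ P := by
    intro s s0 s1 hin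
    have e : ln W h s = ln w1 h (θ + s * (1 - θ)) := by ext <;> simp [hW] <;> ring
    rw [e] at hin
    have hpos : 0 < s * (1 - θ) := mul_pos s0 (by linarith)
    have := hmax _ ⟨⟨by linarith, by nlinarith⟩, hin⟩
    linarith
  have hVW : Vis P V W := by
    intro q hq
    obtain ⟨s, s0, s1, rfl⟩ := mem_seg_ln.1 hq
    rcases eq_or_lt_of_le s0 with e | e
    · rw [← e, ln_zero]; exact hVP
    · exact (hcone W hWb s e s1).2 hWP
  have cVWh : cr V W h = (1 - θ) * t * cr V w0 h := by simp [hW, hw1, cr]; ring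
  have cVWh0 : 0 < cr V W h := by
    rw [cVWh]; exact mul_pos (mul_pos (by linarith) ht) xh
  have cVw0W : cr V w0 W = θ * cr V w0 h := by simp [hW, hw1, cr]; ring
  have hW2 : 0 < W.2 := hball2 W hWb
  -- side property
  have side : ∀ k, Vis P k W → cr V W k ≤ 0 := by
    intro k hk
    by_contra hcon
    push Not at hcon
    have e1 : cr h V W = cr V W h := by simp [cr]; ring
    obtain ⟨ρ, hρ, hρb⟩ := nhd_pos (A := h) (B := V) (z := W) (by rw [e1]; exact cVWh0)
    have eW : ∀ t, ln W k t = W + t • (k - W) := by intro t; ext <;> simp [ln]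
    obtain ⟨ρ', hρ', hρb'⟩ := Metric.isOpen_iff.1 Metric.isOpen_ball W hWb
    obtain ⟨s, s0, hsb⟩ := small_mem W (k - W) (lt_min hρ hρ')
    rw [← eW] at hsb
    -- shrink s to be at most one
    have hsb' : ln W k (min s 1) ∈ Metric.ball W (min ρ ρ') := by
      have h2 : ln W k (min s 1) ∈ segment ℝ (ln W k 0) (ln W k s) :=
        ln_between (le_min s0.le zero_le_one) (min_le_left _ _)
      rw [ln_zero] at h2
      exact (convex_ball W _).segment_subset (Metric.mem_ball_self (lt_min hρ hρ')) hsb h2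
    have r0 : 0 < min s 1 := lt_min s0 one_pos
    have r1 : min s 1 ≤ 1 := min_le_right _ _
    generalize min s 1 = r at *
    set q := ln W k r with hq
    have hqP : q ∈ P := hk.symm (ln_mem_seg r0.le r1)
    have hqb : q ∈ Metric.ball V ε := hρb' (Metric.ball_subset_ball (min_le_right _ _) hsb')
    have hα : 0 < cr h V q := hρb q (lt_of_lt_of_le hsb' (min_le_left _ _))
    have hβ : 0 < cr V W q := by
      have : cr V W q = r * cr V W k := by simp [hq, cr]; ring
      rw [this]; positivity
    set α := cr h V q with hαd
    set β := cr V W q with hβd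
    set Δ := cr V W h with hΔ
    have hsum : 0 < α + β := by linarith
    set y := ln W h (β / (α + β)) with hy
    have hyP : y ∉ P := out _ (by positivity) (by rw [div_le_one hsum]; linarith)
    have hyb : y ∈ Metric.ball V ε := (convex_ball V ε).segment_subset hWb hhb
      (ln_mem_seg (by positivity) (by rw [div_le_one hsum]; linarith))
    -- y = V + (Δ/(α+β)) (q - V)
    have i1 : Δ * (q.1 - V.1) = α * (W.1 - V.1) + β * (h.1 - V.1) := by
      simp only [hΔ, hαd, hβd, cr]; ring
    have i2 : Δ * (q.2 - V.2) = α * (W.2 - V.2) + β * (h.2 - V.2) := by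
      simp only [hΔ, hαd, hβd, cr]; ring
    have yq : y = ln V q (Δ / (α + β)) := by
      ext
      · simp only [hy, ln_fst]; field_simp; linarith
      · simp only [hy, ln_snd]; field_simp; linarith
    have qy : q = ln V y ((α + β) / Δ) := by
      have hΔ0 : Δ ≠ 0 := cVWh0.ne'
      rw [yq]
      ext
      · simp only [ln_fst]; field_simp; ring
      · simp only [ln_snd]; field_simp; ring
    rcases le_total Δ (α + β) with hle | hle
    · apply hyP
      rw [yq]
      exact (hcone q hqb _ (by positivity) (by rw [div_le_one hsum]; exact hle)).2 hqP
    · apply hyP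
      rw [qy] at hqP
      exact (hcone y hyb _ (by positivity) (by rw [div_le_one cVWh0]; exact hle)).1 hqP
  have hWf : W ∈ frontier P := by
    refine ⟨subset_closure hWP, fun hi => ?_⟩
    obtain ⟨ρ, hρ, hb⟩ := Metric.isOpen_iff.1 isOpen_interior W hi
    obtain ⟨s, s0, hsb⟩ := small_mem W (h - W) hρ
    have eW : ∀ t, ln W h t = W + t • (h - W) := by intro t; ext <;> simp [ln]
    have h2 : ln W h (min s 1) ∈ segment ℝ (ln W h 0) (ln W h s) :=
      ln_between (le_min s0.le zero_le_one) (min_le_left _ _)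
    rw [ln_zero] at h2
    have := (convex_ball W _).segment_subset (Metric.mem_ball_self hρ) (by rw [eW]; exact hsb) h2
    exact out _ (lt_min s0 one_pos) (min_le_right _ _) (interior_subset (hb this))
  obtain ⟨l, hl⟩ := K.exists_L hWP
  have hlv := hl.2.2.1
  have sl := side _ hlv
  have hVl0 : Vis P V (ax l0) := hw0v.subr hB.1
  -- cr (ax l0) V W
  have cl0 : ∀ q, (1 - ζ) * cr (ax l0) V q = ζ * cr V w0 q := by intro q; rw [hVe]; simp [cr]; ring
  have cl0W : 0 ≤ cr (ax l0) V W := by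
    have h1 : 0 ≤ (1 - ζ) * cr (ax l0) V W := by
      rw [cl0, cVw0W]; exact mul_nonneg hζ0.le (mul_nonneg t0 xh.le)
    exact (mul_nonneg_iff_of_pos_left (by linarith)).1 h1
  have above : cr (ax l0) V W = 0 → V.2 < W.2 := by
    intro h0
    have h1 := cl0 W
    rw [h0, mul_zero, cVw0W] at h1
    have h2 : θ = 0 := by
      have := (mul_eq_zero.1 h1.symm).resolve_left hζ0.ne'
      exact (mul_eq_zero.1 this).resolve_right xh.ne'
    have : W.2 = V.2 + t * (w0.2 - V.2) := by simp [hW, h2, hw1]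
    rw [this]
    have := mul_pos ht (sub_pos.2 hVs)
    linarith
  have hll : l0 ≤ l := by
    by_contra hcon
    push Not at hcon
    have e1 : cr V W (ax l0) = cr (ax l0) V W := by simp [cr]; ring
    have e2 : cr V W (ax l0) - cr V W (ax l) = (V.2 - W.2) * (l0 - l) := by simp [cr]; ring
    have e3 : 0 < cr (ax l0) V W := by
      refine lt_of_le_of_ne cl0W (fun h0 => ?_)
      have := above h0.symm
      have : (V.2 - W.2) * (l0 - l) < 0 := mul_neg_of_neg_of_pos (by linarith) (by linarith)
      linarith
    have vis : Vis P W (ax l0) := by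
      apply K.diag (C := V) (D := ax l)
      · rw [← cr_cyc, ← cr_cyc, ← cr_cyc, ← cr_cyc]
        have : cr W (ax l0) V = cr (ax l0) V W := by simp [cr]; ring
        simpa only [cr_cyc, this] using e3
      · have : cr W (ax l0) (ax l) = (l - l0) * W.2 := by simp [cr]; ring
        rw [this]; exact mul_neg_of_neg_of_pos (by linarith) hW2
      · exact hVW.symm
      · exact hVl0
      · exact K.vis_ax hl0.1 hl0.2.1 hl.1 hl.2.1
      · exact hlv
    have := side _ vis.symm
    linarith
  have c0 : cr (ax l) W V = 0 := by
    apply le_antisymm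
    · exact K.lemL hW2 hV0 hVW.symm hVL.1 hVL.2.2.1.symm hl (by linarith)
    · have : cr (ax l) W V = - cr V W (ax l) := by simp [cr]; ring
      rw [this]; linarith
  have hVln := coll_ln c0 (by simpa using hW2.ne')
  simp only [ax_snd, sub_zero] at hVln
  set ν := V.2 / W.2 with hν
  have hν0 : 0 < ν := by positivity
  have hν1 : ν < 1 := by
    by_contra hcon
    push Not at hcon
    have e1 : ν * cr (ax l0) V W = (ν - 1) * (- (V.2 * (l - l0))) := by
      have hV1 : V.1 = l + ν * (W.1 - l) := by have := congrArg Prod.fst hVln; simpa using this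
      have hV2' : V.2 = ν * W.2 := by rw [hν]; field_simp
      simp only [cr, ax_fst, ax_snd]
      rw [hV1, hV2']; ring
    have h1 : 0 ≤ (ν - 1) * (V.2 * (l - l0)) := mul_nonneg (by linarith) (mul_nonneg hV0.le (by linarith))
    have h2 : ν * cr (ax l0) V W ≤ 0 := by rw [e1]; linarith
    have h3 : cr (ax l0) V W = 0 := by
      apply le_antisymm _ cl0W
      by_contra h; push Not at h
      have := mul_pos hν0 h
      linarith
    have h4 := above h3
    have : ν < 1 := by rw [hν, div_lt_one hW2]; exact h4
    linarith
  have cVW : ∀ q, cr V W q = (1 - ν) * cr (ax l) W q := by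
    intro q
    have hV1 : V.1 = l + ν * (W.1 - l) := by have := congrArg Prod.fst hVln; simpa using this
    have hV2' : V.2 = ν * W.2 := by rw [hν]; field_simp
    simp only [cr, ax_fst, ax_snd]
    rw [hV1, hV2']; ring
  have posl : ∀ q, 0 < cr V W q → 0 < cr (ax l) W q := by
    intro q hq
    rw [cVW] at hq
    exact (mul_pos_iff_of_pos_left (by linarith)).1 hq
  have hch := posl h cVWh0
  -- h is not in the cone of p and l0
  have hhp : 0 < cr V h p := by
    by_contra hcon
    push Not at hcon
    have g1 : 0 < cr V p (ax l0) := by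
      have e : (1 - ζ) * cr V p (ax l0) = ζ * cr V w0 p := by rw [hVe]; simp [cr]; ring
      have : 0 < (1 - ζ) * cr V p (ax l0) := by rw [e]; positivity
      exact (mul_pos_iff_of_pos_left (by linarith)).1 this
    have g2 : 0 < cr (ax l0) V h := by
      have := cl0 h
      have h2 : 0 < (1 - ζ) * cr (ax l0) V h := by rw [this]; positivity
      exact (mul_pos_iff_of_pos_left (by linarith)).1 h2
    have g3 : cr p (ax l0) V = cr V p (ax l0) := by simp [cr]; ring
    obtain ⟨ρ, hρ, hρb⟩ := nhd_pos (A := p) (B := ax l0) (z := V) (by rw [g3]; exact g1)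
    have eW : ∀ t, ln V h t = V + t • (h - V) := by intro t; ext <;> simp [ln]
    obtain ⟨s, s0, hsb⟩ := small_mem V (h - V) hρ
    rw [← eW] at hsb
    have h2 : ln V h (min s 1) ∈ segment ℝ (ln V h 0) (ln V h s) :=
        ln_between (le_min s0.le zero_le_one) (min_le_left _ _)
    rw [ln_zero] at h2
    have hsb' := (convex_ball V _).segment_subset (Metric.mem_ball_self hρ) hsb h2
    have r0 : 0 < min s 1 := lt_min s0 one_pos
    have r1 : min s 1 ≤ 1 := min_le_right _ _
    generalize min s 1 = r at *
    apply hhP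
    rw [← hcone h hhb r r0 r1]
    apply hT
    apply tri_of_cr g1
    · have : cr V p (ln V h r) = r * (- cr V h p) := by simp [cr]; ring
      rw [this]; exact mul_nonneg r0.le (by linarith)
    · exact (hρb _ hsb').le
    · have : cr (ax l0) V (ln V h r) = r * cr (ax l0) V h := by simp [cr]; ring
      rw [this]; positivity
  have cVWp : 0 < cr V W p := by
    have e : cr V w0 h * cr V W p = cr V w0 p * cr V W h + cr V w0 W * cr V h p := by
      simp only [cr]; ring
    have h1 : 0 ≤ cr V w0 W := by rw [cVw0W]; exact mul_nonneg t0 xh.le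
    have : 0 < cr V w0 h * cr V W p := by
      rw [e]
      have := mul_pos xp cVWh0
      have := mul_nonneg h1 hhp.le
      linarith
    exact (mul_pos_iff_of_pos_left xh).1 this
  refine ⟨W, l, ν, hWf, hl, hll, hν0, hν1, hVln, ⟨?_, ?_⟩, posl p cVWp, ?_⟩
  · have := param_seg (s := W) (l := l) hν0.le hν1.le
    rwa [← hVln] at this
  · intro η hη
    have eW : ∀ t, ln V h t = V + t • (h - V) := by intro t; ext <;> simp [ln]
    obtain ⟨s, s0, hsb⟩ := small_mem V (h - V) hη
    rw [← eW] at hsb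
    have h2 : ln V h (min s 1) ∈ segment ℝ (ln V h 0) (ln V h s) :=
        ln_between (le_min s0.le zero_le_one) (min_le_left _ _)
    rw [ln_zero] at h2
    have hsb' := (convex_ball V _).segment_subset (Metric.mem_ball_self hη) hsb h2
    have r0 : 0 < min s 1 := lt_min s0 one_pos
    have r1 : min s 1 ≤ 1 := min_le_right _ _
    generalize min s 1 = r at *
    refine ⟨ln V h r, ?_, hsb', ?_, ?_⟩
    · rw [hcone h hhb r r0 r1]; exact hhP
    · exact (hball2 _ ((convex_ball V ε).segment_subset (Metric.mem_ball_self hε) hhb (ln_mem_seg r0.le r1))).le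
    · rw [cr_ln, c0]
      have := mul_pos r0 hch
      linarith
  · intro k hk
    have := side k hk
    rw [cVW] at this
    by_contra hc; push Not at hc
    have := mul_pos (show 0 < 1 - ν by linarith) hc
    linarith

end WV


namespace WV

variable {P N : Set (ℝ × ℝ)} {u w : ℝ}

def ZZ (P N : Set (ℝ × ℝ)) (u w : ℝ) (k z : ℝ × ℝ) : Prop :=
  z ∈ N ∧ ∃ c, IsL P u w k c ∧ ((c = u ∧ z = ax u) ∨ (u < c ∧ 0 < k.2 ∧ Low P k c z))

lemma ZZ.unique {k z z' : ℝ × ℝ} (h : ZZ P N u w k z) (h' : ZZ P N u w k z') : z = z' := by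
  obtain ⟨-, c, hc, h⟩ := h
  obtain ⟨-, c', hc', h'⟩ := h'
  obtain rfl := hc.unique hc'
  rcases h with ⟨rfl, rfl⟩ | ⟨h1, h2, h3⟩
  · rcases h' with ⟨-, rfl⟩ | ⟨h1', -⟩
    · rfl
    · exact absurd h1' (lt_irrefl _)
  · rcases h' with ⟨rfl, -⟩ | ⟨-, -, h3'⟩
    · exact absurd h1 (lt_irrefl _)
    · exact h3.unique h2 h3'

structure Cfg (P : Set (ℝ × ℝ)) (u w : ℝ) (p : ℝ × ℝ) (a : ℝ) (V W : ℝ × ℝ) (l ν μ τ : ℝ) : Prop where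
  hp : 0 < p.2
  ha : IsL P u w p a
  hal : a < l
  hl : IsL P u w W l
  hW : 0 < W.2
  hν1 : ν < 1
  hV : V = ln (ax l) W ν
  blk : Blk P W l V
  hT : Tri V p (ax l) ⊆ P
  hτ : 1 < τ
  hm : ln (ax a) p τ = ln (ax l) W μ
  hμ0 : 0 < μ
  hμν : μ ≤ ν
  side : ∀ k, Vis P k W → cr (ax l) W k ≤ 0

section
variable {p V W k : ℝ × ℝ} {a l ν μ τ c : ℝ}

lemma Cfg.inT (C : Cfg P u w p a V W l ν μ τ) {ζ : ℝ} (h0 : 0 ≤ ζ) (h1 : ζ ≤ ν) :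
    ln (ax l) W ζ ∈ Tri V p (ax l) := by
  have := ln_between (A := ax l) (B := W) h0 h1
  rw [ln_zero, ← C.hV] at this
  exact tri_seg (tri_c _ _ _) (tri_a _ _ _) this

lemma Cfg.visp (C : Cfg P u w p a V W l ν μ τ) {q : ℝ × ℝ} (hq : q ∈ Tri V p (ax l)) :
    Vis P q p := ((convex_convexHull ℝ _).segment_subset hq (tri_b _ _ _)).trans C.hT

lemma Cfg.pm (C : Cfg P u w p a V W l ν μ τ) : Vis P p (ln (ax a) p τ) := by
  rw [C.hm]; exact (C.visp (C.inT C.hμ0.le C.hμν)).symm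

lemma Cfg.am (C : Cfg P u w p a V W l ν μ τ) : Vis P (ax a) (ln (ax a) p τ) := by
  have := vis_glue (A := ax a) (B := p) (s := 0) (r := 1) (t := τ) (P := P) (by simpa using C.ha.2.2.1)
        (by simpa using C.pm) zero_le_one C.hτ.le
  simpa using this

lemma Cfg.lm (C : Cfg P u w p a V W l ν μ τ) {ζ : ℝ} (h0 : 0 ≤ ζ) (h1 : ζ ≤ 1) :
    ln (ax l) W ζ ∈ segment ℝ W (ax l) := param_seg h0 h1

lemma Cfg.k0 (K : Core P N u w) (C : Cfg P u w p a V W l ν μ τ) (hk : Vis P k W) (hkp : ¬ Vis P k p) :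
    0 < k.2 := by
  refine lt_of_le_of_ne (K.half k hk.left) (fun h0 => ?_)
  have hL := K.L_low hk.left h0.symm
  have hkl := K.vis_low hk.left h0.symm C.hl.1 C.hl.2.1
  have hkm : Vis P k (ln (ax a) p τ) := by
    rw [C.hm]
    exact K.vis_tri hk C.hl.2.2.1.symm hkl.symm (tri_a _ _ _)
      (tri_seg (tri_b _ _ _) (tri_c _ _ _) (C.lm C.hμ0.le (by linarith [C.hμν, C.hν1])))
  obtain ⟨c, hc, hac, -⟩ := K.lemS C.hp C.ha C.hτ C.pm hkm hkp
  have := hc.unique hL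
  linarith [C.ha.1]

lemma Cfg.cl (K : Core P N u w) (C : Cfg P u w p a V W l ν μ τ) (hk : Vis P k W) (hk0 : 0 < k.2)
    (hc : IsL P u w k c) : c ≤ l := by
  by_contra hlt
  push Not at hlt
  have hWl := C.hl.2.2.1
  have hkl : Vis P (ax l) k := by
    rcases lt_or_eq_of_le (C.side k hk) with h | h
    · refine Vis.symm (K.diag (C := ax c) (D := W) ?_ ?_ hc.2.2.1.symm
        (K.vis_ax hc.1 hc.2.1 C.hl.1 C.hl.2.1) hWl hk.symm)
      · have : cr k (ax l) (ax c) = (c - l) * k.2 := by simp [cr]; ring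
        rw [this]; exact mul_pos (by linarith) hk0
      · rw [← cr_cyc]; exact h
    · have e := coll_ln h (by simpa using C.hW.ne')
      simp only [ax_snd, sub_zero] at e
      have hκ : 0 < k.2 / W.2 := div_pos hk0 C.hW
      generalize k.2 / W.2 = κ at *
      rcases le_total κ 1 with h1 | h1
      · rw [e]; exact hWl.subl (ln_mem_seg hκ.le h1)
      · have := vis_glue (A := ax l) (B := W) (s := 0) (r := 1) (t := κ) (P := P) (by simpa using hWl)
          (by simpa [← e] using hk.symm) zero_le_one h1
        simpa [← e] using this
  have := hc.2.2.2 l C.hl.1 C.hl.2.1 hkl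
  linarith

lemma Cfg.psia (C : Cfg P u w p a V W l ν μ τ) {t : ℝ} :
    τ * cr (ax l) W (ln (ax a) p t) = (τ - t) * (W.2 * (l - a)) := by
  have h : cr (ax l) W (ln (ax a) p τ) = 0 := by rw [C.hm]; simp [cr]; ring
  rw [cr_ln] at h ⊢
  have e : cr (ax l) W (ax a) = W.2 * (l - a) := by simp [cr]; ring
  rw [e] at h ⊢
  linear_combination t * h

lemma Cfg.ceq (K : Core P N u w) (C : Cfg P u w p a V W l ν μ τ) (hk : Vis P k W) (hk0 : 0 < k.2)
    (hkp : ¬ Vis P k p) (hc : IsL P u w k l) : ∃ z, ZZ P N u w k z ∧ Vis P z p := by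
  have hWl := C.hl.2.2.1
  have hμ1 : μ ≤ 1 := by linarith [C.hμν, C.hν1]
  have hkm : Vis P k (ln (ax a) p τ) := by
    rw [C.hm]
    exact K.vis_tri hk hWl.symm hc.2.2.1 (tri_a _ _ _)
      (tri_seg (tri_b _ _ _) (tri_c _ _ _) (C.lm C.hμ0.le hμ1))
  obtain ⟨c', hc', hac, τ', t1, t2, hd⟩ := K.lemS C.hp C.ha C.hτ C.pm hkm hkp
  obtain rfl := hc'.unique hc
  obtain ⟨η, e0, e1, he⟩ := seg_param hd
  have hdpos : 0 < (ln (ax a) p τ').2 := by simp; exact mul_pos (by linarith) C.hp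
  have hη : 0 < η := by
    refine lt_of_le_of_ne e0 (fun h => ?_)
    rw [he, ← h] at hdpos; simp at hdpos
  have hpsi := C.side k hk
  have hps : cr (ax c') W (ln (ax a) p τ') = η * cr (ax c') W k := by
    rw [he, cr_ln]; simp [cr]
  have hz1 := C.psia (t := τ')
  have hla : 0 < W.2 * (c' - a) := mul_pos C.hW (by linarith)
  have hτ'' : τ' = τ := by
    by_contra hne
    have : 0 < τ - τ' := by
      rcases lt_or_eq_of_le t2 with h | h
      · linarith
      · exact absurd h hne
    have h1 := mul_pos this hla
    rw [← hz1, hps] at h1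
    have h2 := mul_nonpos_of_nonneg_of_nonpos (mul_nonneg (by linarith [C.hτ] : (0:ℝ) ≤ τ) hη.le) hpsi
    nlinarith
  subst hτ''
  have hul : u < c' := lt_of_le_of_lt C.ha.1 C.hal
  obtain ⟨z, hz, hzk⟩ := K.B2 hc hul hk0
  have hmz := B3a hk0 hz.1 hd C.hal (K.tri (K.vis_ax C.ha.1 C.ha.2.1 hc.1 hc.2.1) (hc.2.2.1.symm.subr hd).symm C.am.symm)
  have hz0 : 0 < z.2 := by linarith
  have hpk : cr (ax c') W k = 0 := by
    have : η * cr (ax c') W k = 0 := by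
      rw [← hps]
      have : τ' * cr (ax c') W (ln (ax a) p τ') = 0 := by rw [hz1]; ring
      rcases mul_eq_zero.1 this with h | h
      · linarith [C.hτ]
      · exact h
    rcases mul_eq_zero.1 this with h | h
    · exact absurd h hη.ne'
    · exact h
  refine ⟨z, ⟨K.B4 hc.2.2.1.symm hz hz0 hzk, c', hc, Or.inr ⟨hul, hk0, hz⟩⟩, ?_⟩
  have ek := coll_ln hpk (by simpa using C.hW.ne')
  simp only [ax_snd, sub_zero] at ek
  have hκ : 0 < k.2 / W.2 := div_pos hk0 C.hW
  have hkk : k.2 = (k.2 / W.2) * W.2 := by rw [div_mul_cancel₀ _ C.hW.ne']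
  set κ := k.2 / W.2 with hκdef
  clear_value κ
  have hzV : z.2 ≤ V.2 := by
    rcases le_total V.2 k.2 with h | h
    · apply hz.2
      have hV2 : V.2 = ν * W.2 := by rw [C.hV]; simp
      have hνκ : ν ≤ κ := by
        have h : ν * W.2 ≤ κ * W.2 := by linarith
        exact le_of_mul_le_mul_right h C.hW
      refine ⟨?_, fun ε hε => ?_⟩
      · rw [C.hV, segment_symm]
        have := ln_between (A := ax c') (B := W) (by linarith [C.hμν, C.hμ0] : (0:ℝ) ≤ ν) hνκ
        rwa [ln_zero, ← ek] at this
      · obtain ⟨h, h1, h2, h3, h4⟩ := C.blk.2 ε hε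
        refine ⟨h, h1, h2, h3, ?_⟩
        have : cr (ax c') k h = κ * cr (ax c') W h := by
          rw [ek]; simp [cr]; ring
        rw [this]; exact mul_pos hκ h4
    · linarith
  obtain ⟨ζ, b0, b1, ez⟩ := seg_param hz.1.1
  have ez' : z = ln (ax c') W (ζ * κ) := by
    rw [ez, ek]; ext <;> simp <;> ring
  rw [ez']
  apply C.visp
  apply C.inT (by positivity)
  have hV2 : V.2 = ν * W.2 := by rw [C.hV]; simp
  have : (ζ * κ) * W.2 ≤ ν * W.2 := by
    rw [← hV2]
    have : z.2 = (ζ * κ) * W.2 := by rw [ez']; simp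
    linarith
  exact le_of_mul_le_mul_right this C.hW
end
end WV


namespace WV
variable {P N : Set (ℝ × ℝ)} {u w : ℝ}
section
variable {p V W k : ℝ × ℝ} {a l ν μ τ c : ℝ}

lemma Cfg.clt (K : Core P N u w) (C : Cfg P u w p a V W l ν μ τ) (hk : Vis P k W) (hk0 : 0 < k.2)
    (hkp : ¬ Vis P k p) (hc : IsL P u w k c) (hcl : c < l) : ∃ z, ZZ P N u w k z ∧ Vis P z p := by
  have hWl := C.hl.2.2.1
  have hμ1 : μ ≤ 1 := by linarith [C.hμν, C.hν1]
  have hcl' : Vis P (ax c) (ax l) := K.vis_ax hc.1 hc.2.1 C.hl.1 C.hl.2.1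
  have hpc : cr (ax l) W (ax c) = W.2 * (l - c) := by simp [cr]; ring
  have hpc0 : 0 < W.2 * (l - c) := mul_pos C.hW (by linarith)
  obtain ⟨f, hf, hf0⟩ := crossing (A := ax l) (B := W) (X := ax c) (Y := k) (by rw [hpc]; exact hpc0.le) (C.side k hk)
  obtain ⟨θ, t0, t1, eθ⟩ := seg_ln hf
  have hθ : 0 < θ := by
    refine lt_of_le_of_ne t0 (fun h => ?_)
    rw [eθ, ← h, ln_zero, hpc] at hf0
    exact hpc0.ne' hf0
  have hf2 : f.2 = θ * k.2 := by rw [eθ]; simp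
  have hfpos : 0 < f.2 := by rw [hf2]; positivity
  have ef := coll_ln hf0 (by simpa using C.hW.ne')
  simp only [ax_snd, sub_zero] at ef
  have hφ : 0 < f.2 / W.2 := div_pos hfpos C.hW
  have hφf : f.2 = (f.2 / W.2) * W.2 := by rw [div_mul_cancel₀ _ C.hW.ne']
  set φ := f.2 / W.2 with hφdef
  clear_value φ
  -- position of points of the line l W with respect to c k
  have hlc : cr (ax c) k (ax l) = - (k.2 * (l - c)) := by simp [cr]
  have hkl0 : 0 < k.2 * (l - c) := mul_pos hk0 (by linarith)
  have hcf : cr (ax c) k f = 0 := mem_seg_cr hf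
  have posl : ∀ t, φ * cr (ax c) k (ln (ax l) W t) = (t - φ) * (k.2 * (l - c)) := by
    intro t
    have h := hcf
    rw [ef, cr_ln, hlc] at h
    rw [cr_ln, hlc]
    linear_combination t * h
  have hcW := posl 1
  rw [ln_one] at hcW
  have hφ1 : φ ≤ 1 := by
    by_contra hgt
    push Not at hgt
    have hneg : cr (ax c) k W < 0 := by
      have : (1 - φ) * (k.2 * (l - c)) < 0 := mul_neg_of_neg_of_pos (by linarith) hkl0
      rw [← hcW] at this
      by_contra h; push Not at h
      have := mul_nonneg hφ.le h
      linarith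
    have : Vis P W (ax c) := by
      refine K.diag (C := ax l) (D := k) ?_ ?_ hWl.symm hcl'.symm hc.2.2.1 hk
      · have : cr W (ax c) (ax l) = W.2 * (l - c) := by simp [cr]; ring
        rw [this]; exact hpc0
      · rw [← cr_cyc]; exact hneg
    have := C.hl.2.2.2 c hc.1 hc.2.1 this.symm
    linarith
  have hfW : f ∈ segment ℝ W (ax l) := by rw [ef]; exact param_seg hφ.le hφ1
  have hck := hc.2.2.1
  have hfc : Vis P f (ax c) := (hck.subl hf).symm
  have hfk : Vis P f k := hck.subr hf
  have hWf : Vis P W f := hWl.symm.subl hfW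
  have hfl : Vis P f (ax l) := hWl.symm.subr hfW
  have hV2 : V.2 = ν * W.2 := by rw [C.hV]; simp
  have hφν : φ ≤ ν := by
    have := B3a C.hW C.blk hfW hcl (K.tri hcl' hfl.symm hfc)
    rw [hφf, hV2] at this
    exact le_of_mul_le_mul_right this C.hW
  have hcW0 : 0 < cr (ax c) k W := by
    have : 0 < (1 - φ) * (k.2 * (l - c)) := mul_pos (by linarith [C.hν1]) hkl0
    rw [← hcW] at this
    exact (mul_pos_iff_of_pos_left hφ).1 this
  have hca : cr (ax c) k (ax a) = k.2 * (c - a) := by simp [cr]; ring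
  have hmWl : ln (ax l) W μ ∈ segment ℝ W (ax l) := param_seg C.hμ0.le hμ1
  have hμφ : μ ≤ φ := by
    by_contra hgt
    push Not at hgt
    have hmf : ln (ax l) W μ ∈ segment ℝ f W := by
      have := ln_between (A := ax l) (B := W) hgt.le hμ1
      rwa [ln_one, ← ef] at this
    have hkm : Vis P k (ln (ax a) p τ) := by
      rw [C.hm]
      exact K.vis_tri hk hWf hfk (tri_a _ _ _) (tri_seg (tri_c _ _ _) (tri_b _ _ _) hmf)
    obtain ⟨c', hc', hac, τ', t1, t2, hd⟩ := K.lemS C.hp C.ha C.hτ C.pm hkm hkp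
    obtain rfl := hc'.unique hc
    have h0 : cr (ax c') k (ln (ax a) p τ') = 0 := by
      rw [segment_symm] at hd; exact mem_seg_cr hd
    have h1 : τ' * cr (ax c') k (ln (ax a) p τ) = (τ' - τ) * (k.2 * (c' - a)) := by
      rw [cr_ln, hca] at h0 ⊢
      linear_combination τ * h0
    have h2 : (τ' - τ) * (k.2 * (c' - a)) ≤ 0 :=
      mul_nonpos_of_nonpos_of_nonneg (by linarith) (mul_pos hk0 (by linarith)).le
    have h3 := posl μ
    rw [← C.hm] at h3
    have h4 : 0 < (μ - φ) * (k.2 * (l - c')) := mul_pos (by linarith) hkl0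
    rw [← h3] at h4
    have h5 := (mul_pos_iff_of_pos_left hφ).1 h4
    have h6 := mul_pos (by linarith : 0 < τ') h5
    linarith
  have hfT : f ∈ Tri V p (ax l) := by rw [ef]; exact C.inT hφ.le hφν
  have hpam : p ∈ segment ℝ (ax a) (ln (ax a) p τ) := by
    have := ln_between (A := ax a) (B := p) zero_le_one C.hτ.le
    rwa [ln_zero, ln_one] at this
  have hmlf : ln (ax a) p τ ∈ segment ℝ (ax l) f := by
    have := ln_between (A := ax l) (B := W) C.hμ0.le hμφ
    rwa [ln_zero, ← ef, ← C.hm] at this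
  have hac : a ≤ c := by
    by_contra hlt
    push Not at hlt
    have : Vis P (ax c) p := by
      refine K.vis_tri hfc hcl' hfl.symm (tri_b _ _ _) ?_
      refine tri_seg ?_ ?_ hpam
      · exact tri_seg (tri_b _ _ _) (tri_c _ _ _) (ax_seg hlt.le C.hal.le)
      · exact tri_seg (tri_c _ _ _) (tri_a _ _ _) hmlf
    have := C.ha.2.2.2 c hc.1 hc.2.1 this
    linarith
  rcases eq_or_lt_of_le hc.1 with huc | huc
  · have hau : a = u := le_antisymm (by linarith) C.ha.1
    refine ⟨ax u, ⟨K.uN, c, hc, Or.inl ⟨huc.symm, rfl⟩⟩, ?_⟩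
    rw [← hau]; exact C.ha.2.2.1
  obtain ⟨z, hz, hzk⟩ := K.B2 hc huc hk0
  have hfk' : f ∈ segment ℝ k (ax c) := by rw [segment_symm]; exact hf
  have hzf : z.2 ≤ f.2 := by
    by_contra hlt
    push Not at hlt
    exact B3b hk0 (left_mem_segment ℝ _ _) hfk' hzk hlt hcW0 (K.tri hfk hk hWf) hz.1
  obtain ⟨d, δ, hdf, hdδ, hδ0, hδτ, hdz⟩ : ∃ d δ, d ∈ segment ℝ f (ax c) ∧ d = ln (ax a) p δ ∧ 0 ≤ δ ∧ δ ≤ τ ∧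
      d.2 ≤ z.2 := by
    rcases eq_or_lt_of_le hac with he | hlt
    · refine ⟨ax c, 0, right_mem_segment ℝ _ _, by rw [ln_zero, he], le_rfl, by linarith [C.hτ], ?_⟩
      simpa using K.half z (hck.symm hz.1.1)
    · have hf1 : 0 ≤ cr (ax a) p f := by
        have h1 : cr (ax a) p (ln (ax l) W μ) = 0 := by rw [← C.hm]; simp [cr]; ring
        have h2 : cr (ax a) p (ax l) = - (p.2 * (l - a)) := by simp [cr]
        have h3 : μ * cr (ax a) p f = (φ - μ) * (p.2 * (l - a)) := by
          rw [ef]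
          rw [cr_ln, h2] at h1 ⊢
          linear_combination φ * h1
        have h4 : 0 ≤ (φ - μ) * (p.2 * (l - a)) :=
          mul_nonneg (by linarith) (mul_pos C.hp (by linarith)).le
        rw [← h3] at h4
        exact (mul_nonneg_iff_of_pos_left C.hμ0).1 h4
      have hc1 : cr (ax a) p (ax c) ≤ 0 := by
        have h2 : cr (ax a) p (ax c) = - (p.2 * (c - a)) := by simp [cr]
        rw [h2]
        have := mul_pos C.hp (show 0 < c - a by linarith)
        linarith
      obtain ⟨d, hd, hd0⟩ := crossing hf1 hc1
      have ed := coll_ln hd0 (by simpa using C.hp.ne')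
      simp only [ax_snd, sub_zero] at ed
      have hdk : d ∈ segment ℝ k (ax c) := seg_sub hfk' (right_mem_segment ℝ _ _) hd
      have hd2 : 0 ≤ d.2 := K.half d (hck.symm hdk)
      have hδ0 : 0 ≤ d.2 / p.2 := div_nonneg hd2 C.hp.le
      have hδτ : d.2 / p.2 ≤ τ := by
        have h := C.psia (t := d.2 / p.2)
        rw [← ed] at h
        have h1 : 0 ≤ cr (ax l) W d := by
          obtain ⟨r, r0, r1, er⟩ := seg_ln hd
          rw [er, cr_ln, hf0, hpc]
          have := mul_nonneg r0 hpc0.le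
          linarith
        have h2 := mul_nonneg (by linarith [C.hτ] : (0:ℝ) ≤ τ) h1
        rw [h] at h2
        have := (mul_nonneg_iff_of_pos_right (mul_pos C.hW (show 0 < l - a by linarith))).1 h2
        linarith
      refine ⟨d, _, hd, ed, hδ0, hδτ, ?_⟩
      refine B3a hk0 hz.1 hdk hlt (K.tri (K.vis_ax C.ha.1 C.ha.2.1 hc.1 hc.2.1) (hfc.subr hd).symm ?_)
      refine (C.am.subl ?_).symm
      have := ln_between (A := ax a) (B := p) hδ0 hδτ
      rwa [ln_zero, ← ed] at this
  have hdk : d ∈ segment ℝ k (ax c) := seg_sub hfk' (right_mem_segment ℝ _ _) hdf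
  have hz0 : 0 < z.2 := by
    refine lt_of_le_of_ne (K.half z (hck.symm hz.1.1)) (fun h0 => ?_)
    obtain ⟨ζ, b0, b1, ez⟩ := seg_param hz.1.1
    have hzc : z = ax c := by
      have : z.2 = ζ * k.2 := by rw [ez]; simp
      rw [← h0] at this
      rcases mul_eq_zero.1 this.symm with h | h
      · rw [ez, h, ln_zero]
      · exact absurd h hk0.ne'
    obtain ⟨ρ, hρ, hb⟩ := K.lemE huc (lt_of_lt_of_le hcl C.hl.2.1)
    obtain ⟨h, h1, h2, h3, h4⟩ := hz.1.2 ρ hρ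
    rw [hzc] at h2
    exact h1 (hb h h2 h3)
  have hzN := K.B4 hck.symm hz hz0 hzk
  refine ⟨z, ⟨hzN, c, hc, Or.inr ⟨huc, hk0, hz⟩⟩, ?_⟩
  have hzfd : z ∈ segment ℝ d f := by
    obtain ⟨ζ, b0, b1, ez⟩ := seg_param hz.1.1
    obtain ⟨η, g0, g1, ed⟩ := seg_param hdk
    have h1 : η ≤ ζ := by
      have : η * k.2 ≤ ζ * k.2 := by
        have e1 : d.2 = η * k.2 := by rw [ed]; simp
        have e2 : z.2 = ζ * k.2 := by rw [ez]; simp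
        linarith
      exact le_of_mul_le_mul_right this hk0
    have h2 : ζ ≤ θ := by
      have : ζ * k.2 ≤ θ * k.2 := by
        have e2 : z.2 = ζ * k.2 := by rw [ez]; simp
        linarith
      exact le_of_mul_le_mul_right this hk0
    have := ln_between (A := ax c) (B := k) h1 h2
    rwa [← ez, ← ed, ← eθ] at this
  rcases lt_trichotomy δ 1 with h | h | h
  · have hpd : p ∈ segment ℝ d (ln (ax a) p τ) := by
      have := ln_between (A := ax a) (B := p) h.le C.hτ.le
      rwa [ln_one, ← hdδ] at this
    have hfd : Vis P f d := hfc.subl hdf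
    have hdm : Vis P d (ln (ax a) p τ) := by
      refine C.am.subr ?_
      have := ln_between (A := ax a) (B := p) hδ0 hδτ
      rwa [ln_zero, ← hdδ] at this
    have hmf : Vis P (ln (ax a) p τ) f := hfl.symm.subr hmlf
    exact K.vis_tri hfd hdm hmf (tri_seg (tri_b _ _ _) (tri_a _ _ _) hzfd)
      (tri_seg (tri_b _ _ _) (tri_c _ _ _) hpd)
  · rw [h, ln_one] at hdδ
    rw [hdδ] at hdk
    exact absurd (hck.symm.subl hdk) hkp
  · apply C.visp
    have hdp : d ∈ segment ℝ p (ln (ax a) p τ) := by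
      have := ln_between (A := ax a) (B := p) h.le hδτ
      rwa [ln_one, ← hdδ] at this
    have hmT : ln (ax a) p τ ∈ Tri V p (ax l) := by
      rw [C.hm]; exact C.inT C.hμ0.le C.hμν
    exact tri_seg (tri_seg (tri_b _ _ _) hmT hdp) hfT hzfd

lemma Cfg.step4 (K : Core P N u w) (C : Cfg P u w p a V W l ν μ τ) (hk : Vis P k W)
    (hkp : ¬ Vis P k p) : ∃ z, ZZ P N u w k z ∧ Vis P z p := by
  have hk0 := C.k0 K hk hkp
  obtain ⟨c, hc⟩ := K.exists_L hk.left
  rcases lt_or_eq_of_le (C.cl K hk hk0 hc) with h | rfl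
  · exact C.clt K hk hk0 hkp hc h
  · exact C.ceq K hk hk0 hkp hc

end
end WV


namespace WV
variable {P N : Set (ℝ × ℝ)} {u w : ℝ}

lemma continuous_ln (A B : ℝ × ℝ) : Continuous (fun t => ln A B t) := by
  unfold ln; fun_prop

lemma Core.hit (K : Core P N u w) {p : ℝ × ℝ} {a : ℝ} (hp : 0 < p.2) (hpP : p ∈ P) :
    ∃ τ, 1 ≤ τ ∧ ln (ax a) p τ ∈ frontier P ∧ Vis P p (ln (ax a) p τ) := by
  set T : Set ℝ := Set.Ici 1 ∩ {t | ln (ax a) p t ∉ interior P} with hT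
  have hTc : IsClosed T := by
    refine isClosed_Ici.inter ?_
    exact (isOpen_interior.preimage (continuous_ln (ax a) p)).isClosed_compl
  obtain ⟨M, hM⟩ := K.cpt.isBounded.subset_closedBall 0
  have hne : T.Nonempty := by
    refine ⟨max 1 ((M + 1) / p.2), ⟨Set.mem_Ici.2 (le_max_left _ _), fun h => ?_⟩⟩
    have h1 := hM (interior_subset h)
    rw [mem_closedBall_zero_iff] at h1
    have h2 := (norm_snd_le _).trans h1
    rw [Real.norm_eq_abs] at h2
    have h3 := (le_abs_self _).trans h2
    simp only [ln_snd, ax_snd, sub_zero, zero_add] at h3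
    have h4 : (M + 1) / p.2 * p.2 ≤ max 1 ((M + 1) / p.2) * p.2 :=
      mul_le_mul_of_nonneg_right (le_max_right _ _) hp.le
    rw [div_mul_cancel₀ _ hp.ne'] at h4
    linarith
  have hbd : BddBelow T := ⟨1, fun t ht => ht.1⟩
  have hmem : sInf T ∈ T := hTc.csInf_mem hne hbd
  set τ := sInf T with hτ
  have hlt : ∀ t, 1 ≤ t → t < τ → ln (ax a) p t ∈ P := by
    intro t h1 h2
    by_contra h
    have : τ ≤ t := csInf_le hbd ⟨h1, fun h' => h (interior_subset h')⟩
    linarith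
  have hP : ln (ax a) p τ ∈ P := by
    rcases eq_or_lt_of_le (show 1 ≤ τ from hmem.1) with h | h
    · rw [← h, ln_one]; exact hpP
    · have hcl : IsClosed {t | ln (ax a) p t ∈ P} := K.closed.preimage (continuous_ln (ax a) p)
      have hsub : closure (Set.Ico 1 τ) ⊆ {t | ln (ax a) p t ∈ P} :=
        closure_minimal (fun t ht => hlt t ht.1 ht.2) hcl
      rw [closure_Ico h.ne] at hsub
      exact hsub ⟨h.le, le_rfl⟩
  refine ⟨τ, hmem.1, ⟨subset_closure hP, hmem.2⟩, ?_⟩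
  intro q hq
  have e : segment ℝ p (ln (ax a) p τ) = segment ℝ (ln (ax a) p 1) (ln (ax a) p τ) := by rw [ln_one]
  rw [e] at hq
  obtain ⟨r, r0, r1, rfl⟩ := of_ln_between hmem.1 hq
  rcases lt_or_eq_of_le r1 with h | h
  · exact hlt r r0 h
  · rw [h]; exact hP

lemma Core.low_fr (K : Core P N u w) {p : ℝ × ℝ} (hp : p ∈ P) (h0 : p.2 = 0) : p ∈ frontier P := by
  refine ⟨subset_closure hp, fun hi => ?_⟩
  obtain ⟨ε, hε, hb⟩ := Metric.isOpen_iff.1 isOpen_interior p hi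
  obtain ⟨s, s0, hs⟩ := small_mem p (0, -1) hε
  have := K.half _ (interior_subset (hb hs))
  simp [h0] at this
  linarith

lemma Core.unguarded (K : Core P N u w) (hN : N.Finite) (G : Finset (ℝ × ℝ))
    (hG : ∀ x ∈ frontier P, ∃ g ∈ G, Vis P g x) {p : ℝ × ℝ} (hpP : p ∈ P) (hun : ∀ g ∈ G, ¬ Vis P g p) :
    ∃ k ∈ G, ∃ z, ZZ P N u w k z ∧ Vis P z p := by
  classical
  have hp : 0 < p.2 := by
    refine lt_of_le_of_ne (K.half p hpP) (fun h => ?_)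
    obtain ⟨g, hg, hv⟩ := hG p (K.low_fr hpP h.symm)
    exact hun g hg hv
  obtain ⟨a, ha⟩ := K.exists_L hpP
  obtain ⟨τ, h1, hfr, hv⟩ := K.hit (a := a) hp hpP
  obtain ⟨g, hg, hgv⟩ := hG _ hfr
  have h1' : 1 < τ := by
    refine lt_of_le_of_ne h1 (fun h => ?_)
    rw [← h, ln_one] at hgv
    exact hun g hg hgv
  obtain ⟨c, hc, hac, τ', t1, t2, hd⟩ := K.lemS hp ha h1' hv hgv (hun g hg)
  have hCC : CC P u w p a g c := by
    refine ⟨hc, hac, τ', t1, hd, hv.subl ?_⟩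
    have := ln_between (A := ax a) (B := p) t1.le t2
    rwa [ln_one] at this
  -- minimal candidate
  set S : Set (ℝ × ℝ) := {s | s ∈ (↑G ∪ N) ∧ ∃ l, CC P u w p a s l} with hS
  have hSf : S.Finite := (G.finite_toSet.union hN).subset (fun s hs => hs.1)
  have hex : ∀ s : ℝ × ℝ, ∃ l : ℝ, s ∈ S → CC P u w p a s l := by
    intro s
    by_cases h : s ∈ S
    · obtain ⟨l, hl⟩ := h.2; exact ⟨l, fun _ => hl⟩
    · exact ⟨0, fun h' => absurd h' h⟩
  choose L hL using hex
  have hgS : g ∈ S := ⟨Or.inl hg, c, hCC⟩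
  obtain ⟨s, hs, hmin⟩ := Set.exists_min_image S L hSf ⟨g, hgS⟩
  have hsC := hL s hs
  set l0 := L s with hl0
  obtain ⟨hs0, V, hVN, hLow, hVs, hV0, hcrV, lam, hlam, hlaml, hor⟩ := K.Cstep hp ha hsC
  have hVp : Vis P V p := by
    rcases hor with h | h
    · exact h
    · have hVS : V ∈ S := ⟨Or.inr hVN, lam, h⟩
      have h1 := hmin V hVS
      have h2 := (hL V hVS).1.unique h.1
      linarith
  obtain ⟨hsl, hal, τ1, ht1, hm, hpm⟩ := hsC
  have hsv := hsl.2.2.1.symm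
  have hcr : 0 < cr (ax l0) s p := by
    have h0 : cr (ax l0) s (ln (ax a) p τ1) = 0 := by
      rw [segment_symm] at hm; exact mem_seg_cr hm
    have e : cr (ax l0) s (ax a) = s.2 * (l0 - a) := by simp [cr]; ring
    rw [cr_ln, e] at h0
    have h3 : τ1 * cr (ax l0) s p = (τ1 - 1) * (s.2 * (l0 - a)) := by linear_combination h0
    have h4 : 0 < (τ1 - 1) * (s.2 * (l0 - a)) := mul_pos (by linarith) (mul_pos hs0 (by linarith))
    rw [← h3] at h4
    exact (mul_pos_iff_of_pos_left (by linarith)).1 h4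
  obtain ⟨ζ, b0, b1, eV⟩ := seg_param hLow.1.1
  have hVl : Vis P V (ax l0) := hsv.subr hLow.1.1
  have hcrV' : 0 < cr (ax l0) V p := by
    have e : cr (ax l0) V p = ζ * cr (ax l0) s p := by rw [eV]; simp [cr]; ring
    have hζ : 0 < ζ := by
      have : V.2 = ζ * s.2 := by rw [eV]; simp
      rw [this] at hV0
      exact (mul_pos_iff_of_pos_right hs0).1 hV0
    rw [e]; exact mul_pos hζ hcr
  have hT := K.lemN hp ha hal hsl.2.1 hcrV' hVp hVl
  obtain ⟨W, l, ν, hWf, hWl, hll, hν0, hν1, hVW, hblk, hpsi, hside⟩ :=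
    K.step3 hsl hLow.1 hV0 hVs hlam hlaml hT hcr
  obtain ⟨k, hkG, hkW⟩ := hG W hWf
  have hal' : a < l := by linarith
  have hW0 : 0 < W.2 := by
    have : V.2 = ν * W.2 := by rw [hVW]; simp
    rw [this] at hV0
    exact (mul_pos_iff_of_pos_left hν0).1 hV0
  have hcl : 0 < cr (ax l) V p := by
    have e : cr (ax l) V p = ν * cr (ax l) W p := by rw [hVW]; simp [cr]; ring
    rw [e]; exact mul_pos hν0 hpsi
  have hVl' : Vis P V (ax l) := by
    have h := hWl.2.2.1.subl (ln_mem_seg hν0.le hν1.le)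
    rw [← hVW] at h; exact h.symm
  have hT' := K.lemN hp ha hal' hWl.2.1 hcl hVp hVl'
  obtain ⟨τ2, ht2, hm2⟩ := lemM hp hal' hV0 hcl hcrV
  obtain ⟨μ, m0, m1, em⟩ := seg_param hm2
  have em' : ln (ax a) p τ2 = ln (ax l) W (μ * ν) := by
    rw [em, hVW]; ext <;> simp <;> ring
  have hμ : 0 < μ := by
    refine lt_of_le_of_ne m0 (fun h => ?_)
    have := congrArg Prod.snd em
    rw [← h] at this
    simp at this
    rcases this with h | h <;> linarith
  have C : Cfg P u w p a V W l ν (μ * ν) τ2 :=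
    { hp := hp, ha := ha, hal := hal', hl := hWl, hW := hW0, hν1 := hν1, hV := hVW, blk := hblk, hT := hT',
      hτ := ht2, hm := em', hμ0 := mul_pos hμ hν0, hμν := by nlinarith, side := hside }
  exact ⟨k, hkG, C.step4 K hkW (hun k hkG)⟩

theorem core_main (K : Core P N u w) (hN : N.Finite) (G : Finset (ℝ × ℝ))
    (hG : ∀ x ∈ frontier P, ∃ g ∈ G, Vis P g x) :
    ∃ G' : Finset (ℝ × ℝ), ↑G' ⊆ N ∧ G'.card ≤ G.card ∧ ∀ p ∈ P, ∃ g, (g ∈ G ∨ g ∈ G') ∧ Vis P g p := by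
  classical
  have hex : ∀ k : ℝ × ℝ, ∃ z, z ∈ N ∧ ∀ z', ZZ P N u w k z' → z' = z := by
    intro k
    by_cases h : ∃ z, ZZ P N u w k z
    · obtain ⟨z, hz⟩ := h
      exact ⟨z, hz.1, fun z' hz' => hz'.unique hz⟩
    · exact ⟨(u, 0), K.uN, fun z' hz' => absurd ⟨z', hz'⟩ h⟩
  choose F hF1 hF2 using hex
  refine ⟨G.image F, ?_, Finset.card_image_le, ?_⟩
  · intro z hz
    obtain ⟨k, -, rfl⟩ := Finset.mem_image.1 (Finset.mem_coe.1 hz)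
    exact hF1 k
  · intro p hp
    by_cases h : ∃ g ∈ G, Vis P g p
    · obtain ⟨g, hg, hv⟩ := h
      exact ⟨g, Or.inl hg, hv⟩
    · push Not at h
      obtain ⟨k, hk, z, hz, hv⟩ := K.unguarded hN G hG hp h
      rw [hF2 k z hz] at hv
      exact ⟨F k, Or.inr (Finset.mem_image_of_mem F hk), hv⟩

end WV


namespace WV

/-- polygon data in coordinates -/
structure Poly {n : ℕ} [NeZero n] (P : Set (ℝ × ℝ)) (v : Fin n → ℝ × ℝ) : Prop where
  hn : 3 ≤ n
  inj : Function.Injective v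
  fr : frontier P = ⋃ i : Fin n, segment ℝ (v i) (v (i + 1))
  adj : ∀ i : Fin n, segment ℝ (v i) (v (i + 1)) ∩ segment ℝ (v (i + 1)) (v (i + 1 + 1)) = {v (i + 1)}
  dis : ∀ i j : Fin n, i ≠ j → j ≠ i + 1 → i ≠ j + 1 →
    Disjoint (segment ℝ (v i) (v (i + 1))) (segment ℝ (v j) (v (j + 1)))

lemma fin_succ_ne {n : ℕ} [NeZero n] (hn : 3 ≤ n) (i : Fin n) : i + 1 ≠ i := by
  intro h
  have h1 : (1 : Fin n) = 0 := by
    have : i + 1 = i + 0 := by rw [h, add_zero]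
    exact add_left_cancel this
  have := congrArg Fin.val h1
  rw [Fin.val_zero, Fin.val_one', Nat.mod_eq_of_lt (by omega)] at this
  omega

variable {n : ℕ} [NeZero n] {P : Set (ℝ × ℝ)} {v : Fin n → ℝ × ℝ}

lemma Poly.conn (Q : Poly P v) : IsPreconnected (frontier P) := by
  have e : frontier P = ⋃ i : ℕ, segment ℝ (v (Fin.ofNat n i)) (v (Fin.ofNat n i + 1)) := by
    rw [Q.fr]
    ext x
    simp only [Set.mem_iUnion]
    constructor
    · rintro ⟨i, hi⟩
      refine ⟨i.val, ?_⟩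
      have : Fin.ofNat n i.val = i := by ext; simp
      rw [this]; exact hi
    · rintro ⟨i, hi⟩; exact ⟨_, hi⟩
  rw [e]
  apply IsPreconnected.iUnion_of_chain
  · intro i; exact (convex_segment _ _).isPreconnected
  · intro i
    refine ⟨v (Fin.ofNat n i + 1), right_mem_segment ℝ _ _, ?_⟩
    have : Fin.ofNat n (Order.succ i) = Fin.ofNat n i + 1 := by
      rw [Fin.ofNat_add]
      ext
      simp
    rw [this]
    exact left_mem_segment ℝ _ _

/-- a ball missing all edges not containing x -/
lemma Poly.ball (_Q : Poly P v) (x : ℝ × ℝ) : ∃ ε > 0, ∀ j, x ∉ segment ℝ (v j) (v (j + 1)) →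
    ∀ q ∈ Metric.ball x ε, q ∉ segment ℝ (v j) (v (j + 1)) := by
  have hc : IsClosed (⋃ j ∈ {j | x ∉ segment ℝ (v j) (v (j + 1))}, segment ℝ (v j) (v (j + 1))) := by
    apply Set.Finite.isClosed_biUnion (Set.toFinite _)
    intro j _
    rw [← convexHull_pair]; exact (Set.Finite.isCompact_convexHull ℝ (by simp)).isClosed
  obtain ⟨ε, hε, hb⟩ := Metric.isOpen_iff.1 hc.isOpen_compl x (by
    intro h
    simp only [Set.mem_iUnion] at h
    obtain ⟨j, hj, hx⟩ := h
    exact hj hx)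
  refine ⟨ε, hε, fun j hj q hq hqs => hb hq ?_⟩
  simp only [Set.mem_iUnion]
  exact ⟨j, hj, hqs⟩

lemma seg_ray {x y q : ℝ × ℝ} : q ∈ segment ℝ x y ↔ ∃ t : ℝ, 0 ≤ t ∧ t ≤ 1 ∧ q = x + t • (y - x) := by
  rw [segment_eq_image']
  constructor
  · rintro ⟨t, ⟨h0, h1⟩, rfl⟩; exact ⟨t, h0, h1, rfl⟩
  · rintro ⟨t, h0, h1, rfl⟩; exact ⟨t, ⟨h0, h1⟩, rfl⟩

lemma ball_ray {x d : ℝ × ℝ} {t r ε : ℝ} (hd : d ≠ 0) (h : x + t • d ∈ Metric.ball x ε) (hε : ε ≤ r * ‖d‖) :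
    |t| < r := by
  rw [mem_ball_iff_norm] at h
  simp only [add_sub_cancel_left, norm_smul, Real.norm_eq_abs] at h
  have : |t| * ‖d‖ < r * ‖d‖ := lt_of_lt_of_le h hε
  exact lt_of_mul_lt_mul_right this (norm_nonneg _)

lemma Poly.loc (Q : Poly P v) {x : ℝ × ℝ} (hx : x ∈ frontier P) : Loc P (Set.range v) x := by
  obtain ⟨ε0, hε0, hb⟩ := Q.ball x
  by_cases hv : x ∈ Set.range v
  · obtain ⟨i', hi'⟩ := hv
    obtain ⟨i, rfl⟩ : ∃ i, i' = i + 1 := ⟨i' - 1, by simp⟩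
    have hne1 : v i ≠ v (i + 1) := fun h => fin_succ_ne Q.hn i (Q.inj h).symm
    have hne2 : v (i + 1 + 1) ≠ v (i + 1) := fun h => fin_succ_ne Q.hn (i + 1) (Q.inj h)
    subst hi'
    have hd1 : v i - v (i + 1) ≠ 0 := sub_ne_zero.2 hne1
    have hd2 : v (i + 1 + 1) - v (i + 1) ≠ 0 := sub_ne_zero.2 hne2
    have hother : ∀ j, j ≠ i → j ≠ i + 1 → v (i + 1) ∉ segment ℝ (v j) (v (j + 1)) := by
      intro j h1 h2 hm
      by_cases h3 : i = j + 1
      · subst h3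
        have : v (j + 1 + 1) ∈ ({v (j + 1)} : Set (ℝ × ℝ)) := by
          rw [← Q.adj j]; exact ⟨hm, right_mem_segment ℝ _ _⟩
        exact hne1 (Set.mem_singleton_iff.1 this).symm
      · exact Set.disjoint_left.1 (Q.dis i j h1.symm h2 h3) (right_mem_segment ℝ _ _) hm
    refine ⟨min ε0 (min ‖v i - v (i + 1)‖ ‖v (i + 1 + 1) - v (i + 1)‖), ?_, v i - v (i + 1),
      v (i + 1 + 1) - v (i + 1), hd1, hd2, ?_, ?_, ?_⟩
    · exact lt_min hε0 (lt_min (norm_pos_iff.2 hd1) (norm_pos_iff.2 hd2))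
    · intro q hq
      rw [Q.fr]
      simp only [Set.mem_iUnion]
      constructor
      · rintro ⟨j, hj⟩
        by_cases h1 : j = i
        · subst h1
          rw [segment_symm, seg_ray] at hj
          obtain ⟨t, t0, t1, e⟩ := hj
          exact ⟨t, t0, Or.inl e⟩
        · by_cases h2 : j = i + 1
          · subst h2
            rw [seg_ray] at hj
            obtain ⟨t, t0, t1, e⟩ := hj
            exact ⟨t, t0, Or.inr e⟩
          · exact absurd hj (hb j (hother j h1 h2) q (Metric.ball_subset_ball (min_le_left _ _) hq))
      · rintro ⟨t, t0, rfl | rfl⟩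
        · refine ⟨i, ?_⟩
          rw [segment_symm, seg_ray]
          have := ball_ray (r := 1) hd1 hq (by rw [one_mul]; exact (min_le_right _ _).trans (min_le_left _ _))
          exact ⟨t, t0, ((le_abs_self _).trans_lt this).le, rfl⟩
        · refine ⟨i + 1, ?_⟩
          rw [seg_ray]
          have := ball_ray (r := 1) hd2 hq (by rw [one_mul]; exact (min_le_right _ _).trans (min_le_right _ _))
          exact ⟨t, t0, ((le_abs_self _).trans_lt this).le, rfl⟩
    · intro t ht he
      rcases le_total t 1 with h | h
      · have h1 : v (i + 1 + 1) ∈ segment ℝ (v i) (v (i + 1)) := by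
          rw [segment_symm, seg_ray]
          exact ⟨t, ht.le, h, by rw [← he]; simp⟩
        have : v (i + 1 + 1) ∈ ({v (i + 1)} : Set (ℝ × ℝ)) := by
          rw [← Q.adj i]; exact ⟨h1, right_mem_segment ℝ _ _⟩
        exact hne2 (Set.mem_singleton_iff.1 this)
      · have h1 : v i ∈ segment ℝ (v (i + 1)) (v (i + 1 + 1)) := by
          rw [seg_ray]
          refine ⟨t⁻¹, by positivity, inv_le_one_of_one_le₀ h, ?_⟩
          rw [he, smul_smul, inv_mul_cancel₀ ht.ne']; simp
        have : v i ∈ ({v (i + 1)} : Set (ℝ × ℝ)) := by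
          rw [← Q.adj i]; exact ⟨left_mem_segment ℝ _ _, h1⟩
        exact hne1 (Set.mem_singleton_iff.1 this)
    · intro h; exact absurd ⟨i + 1, rfl⟩ h
  · have hx' := hx
    rw [Q.fr] at hx'
    simp only [Set.mem_iUnion] at hx'
    obtain ⟨i, hi⟩ := hx'
    have hother : ∀ j, j ≠ i → x ∉ segment ℝ (v j) (v (j + 1)) := by
      intro j h1 hm
      by_cases h2 : j = i + 1
      · subst h2
        have : x ∈ ({v (i + 1)} : Set (ℝ × ℝ)) := by rw [← Q.adj i]; exact ⟨hi, hm⟩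
        exact hv ⟨_, (Set.mem_singleton_iff.1 this).symm⟩
      · by_cases h3 : i = j + 1
        · subst h3
          have : x ∈ ({v (j + 1)} : Set (ℝ × ℝ)) := by rw [← Q.adj j]; exact ⟨hm, hi⟩
          exact hv ⟨_, (Set.mem_singleton_iff.1 this).symm⟩
        · exact Set.disjoint_left.1 (Q.dis i j (Ne.symm h1) h2 h3) hi hm
    have hne1 : v (i + 1) ≠ v i := fun h => fin_succ_ne Q.hn i (Q.inj h)
    have hd : v (i + 1) - v i ≠ 0 := sub_ne_zero.2 hne1
    have hdn := norm_pos_iff.2 hd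
    obtain ⟨s, s0, s1, es⟩ := seg_ray.1 hi
    have s0' : 0 < s := by
      refine lt_of_le_of_ne s0 (fun h => hv ⟨i, ?_⟩)
      rw [es, ← h]; simp
    have s1' : s < 1 := by
      refine lt_of_le_of_ne s1 (fun h => hv ⟨i + 1, ?_⟩)
      rw [es, h]; simp
    refine ⟨min ε0 (min (s * ‖v (i + 1) - v i‖) ((1 - s) * ‖v (i + 1) - v i‖)), ?_, v (i + 1) - v i,
      -(v (i + 1) - v i), hd, neg_ne_zero.2 hd, ?_, ?_, fun _ => rfl⟩
    · exact lt_min hε0 (lt_min (mul_pos s0' hdn) (mul_pos (by linarith) hdn))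
    · intro q hq
      rw [Q.fr]
      simp only [Set.mem_iUnion]
      constructor
      · rintro ⟨j, hj⟩
        by_cases h1 : j = i
        · subst h1
          rw [seg_ray] at hj
          obtain ⟨t, t0, t1, e⟩ := hj
          rcases le_total s t with h | h
          · exact ⟨t - s, by linarith, Or.inl (by rw [e, es]; module)⟩
          · exact ⟨s - t, by linarith, Or.inr (by rw [e, es]; module)⟩
        · exact absurd hj (hb j (hother j h1) q (Metric.ball_subset_ball (min_le_left _ _) hq))
      · rintro ⟨t, t0, rfl | rfl⟩
        · refine ⟨i, ?_⟩
          have := ball_ray (r := 1 - s) hd hq ((min_le_right _ _).trans (min_le_right _ _))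
          have := (le_abs_self _).trans_lt this
          rw [seg_ray]
          exact ⟨s + t, by linarith, by linarith, by rw [es]; module⟩
        · refine ⟨i, ?_⟩
          have := ball_ray (r := s) (neg_ne_zero.2 hd) hq
            (by rw [norm_neg]; exact (min_le_right _ _).trans (min_le_left _ _))
          have := (le_abs_self _).trans_lt this
          rw [seg_ray]
          exact ⟨s - t, by linarith, by linarith, by rw [es]; module⟩
    · intro t ht he
      have : (1 + t) • (v (i + 1) - v i) = 0 := by
        rw [add_smul, ← he, one_smul]; abel
      rcases smul_eq_zero.1 this with h | h
      · linarith
      · exact hd h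

end WV

namespace WV

lemma exists_coord (f : EuclideanSpace ℝ (Fin 2) →ₗ[ℝ] ℝ) (hf : f ≠ 0) (c : ℝ)
    (x y : EuclideanSpace ℝ (Fin 2)) (hxy : x ≠ y) (hx : f x = c) (hy : f y = c) :
    ∃ (Φ : EuclideanSpace ℝ (Fin 2) ≃ᴬ[ℝ] ℝ × ℝ) (a b : ℝ), a < b ∧ Φ x = (a, 0) ∧ Φ y = (b, 0) ∧
      ∀ q, (Φ q).2 = f q - c := by
  set D : EuclideanSpace ℝ (Fin 2) := y - x with hD
  have hD0 : D ≠ 0 := sub_ne_zero.2 hxy.symm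
  have hfD : f D = 0 := by rw [hD, map_sub, hx, hy, sub_self]
  set g : EuclideanSpace ℝ (Fin 2) →ₗ[ℝ] ℝ := (innerSL ℝ D).toLinearMap with hg
  have hgD : 0 < g D := by
    rw [hg]; simp only [ContinuousLinearMap.coe_coe, innerSL_apply_apply]
    exact real_inner_self_pos.2 hD0
  have hinj : Function.Injective (g.prod f) := by
    rw [← LinearMap.ker_eq_bot, LinearMap.ker_eq_bot']
    intro q hq
    have hq1 : g q = 0 := congrArg Prod.fst hq
    have hq2 : f q = 0 := congrArg Prod.snd hq
    by_contra hq0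
    apply hf
    -- D and q span the plane
    have hli : LinearIndependent ℝ ![D, q] := by
      rw [LinearIndependent.pair_iff]
      intro s t hst
      have h1 := congrArg g hst
      simp only [map_add, map_smul, hq1, map_zero, smul_eq_mul, mul_zero, add_zero] at h1
      have hs : s = 0 := by
        rcases mul_eq_zero.1 h1 with h | h
        · exact h
        · exact absurd h hgD.ne'
      refine ⟨hs, ?_⟩
      rw [hs, zero_smul, zero_add] at hst
      rcases smul_eq_zero.1 hst with h | h
      · exact h
      · exact absurd h hq0
    have hspan := hli.span_eq_top_of_card_eq_finrank' (by simp)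
    apply LinearMap.ext_on hspan
    rintro z ⟨i, rfl⟩
    fin_cases i
    · simpa using hfD
    · simpa using hq2
  let e := LinearMap.linearEquivOfInjective (g.prod f) hinj (by simp)
  have he : ∀ q, e q = (g q, f q) := fun q => rfl
  let Φ : EuclideanSpace ℝ (Fin 2) ≃ᴬ[ℝ] ℝ × ℝ :=
    e.toContinuousLinearEquiv.toContinuousAffineEquiv.trans
      (ContinuousAffineEquiv.constVAdd ℝ (ℝ × ℝ) ((0, -c) : ℝ × ℝ))
  have hΦ : ∀ q, Φ q = (g q, f q - c) := by
    intro q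
    have : Φ q = (0, -c) + e q := rfl
    rw [this, he]
    ext
    · simp
    · simp; ring
  refine ⟨Φ, g x, g y, ?_, ?_, ?_, ?_⟩
  · have : g D = g y - g x := by rw [hD, map_sub]
    linarith
  · rw [hΦ, hx, sub_self]
  · rw [hΦ, hy, sub_self]
  · intro q; rw [hΦ]

lemma seg_img (Φ : EuclideanSpace ℝ (Fin 2) ≃ᴬ[ℝ] ℝ × ℝ) (x y : EuclideanSpace ℝ (Fin 2)) :
    segment ℝ (Φ x) (Φ y) = Φ '' segment ℝ x y :=
  (image_segment ℝ (Φ : EuclideanSpace ℝ (Fin 2) →ᵃ[ℝ] ℝ × ℝ) x y).symm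

end WV

theorem wv_polygon_boundary_guarding {n : ℕ} [NeZero n]
    (P : Set (EuclideanSpace ℝ (Fin 2))) (v : Fin n → EuclideanSpace ℝ (Fin 2))
    (hP : IsSimplePolygonRegion P v)
    -- `P` lies in a closed half-plane bounded by the line through `v (-1)` (= vₙ)
    -- and `v 0` (= v₁); note `[v (-1), v 0]` is automatically an edge of `P`.
    (hhalf : ∃ (f : EuclideanSpace ℝ (Fin 2) →ₗ[ℝ] ℝ) (c : ℝ),
      f ≠ 0 ∧ f (v (-1)) = c ∧ f (v 0) = c ∧ ∀ p ∈ P, c ≤ f p)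
    -- `P` is weakly visible from the edge `[v (-1), v 0]`
    (hwv : ∀ p ∈ P, ∃ q ∈ segment ℝ (v (-1)) (v 0), segment ℝ q p ⊆ P)
    (G : Finset (EuclideanSpace ℝ (Fin 2)))
    (hG_bd : ↑G ⊆ frontier P)
    (hG_guards : ∀ x ∈ frontier P, ∃ g ∈ G, segment ℝ g x ⊆ P) :
    ∃ G' : Finset (EuclideanSpace ℝ (Fin 2)),
      ↑G' ⊆ Set.range v ∧ G'.card ≤ G.card ∧
      ∀ p ∈ P, ∃ g ∈ (↑G ∪ ↑G' : Set (EuclideanSpace ℝ (Fin 2))), segment ℝ g p ⊆ P := by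
  classical
  obtain ⟨hn, hinj, hcpt, -, hreg, hfr, hadj, hdis⟩ := hP
  obtain ⟨f, c, hf, hf1, hf0, hfP⟩ := hhalf
  have hne : v (-1) ≠ v 0 := by
    intro h
    have h1 := hinj h
    exact WV.fin_succ_ne hn (-1) (by rw [neg_add_cancel]; exact h1.symm)
  obtain ⟨Φ, a, b, hab, hΦa, hΦb, hΦ2⟩ := WV.exists_coord f hf c (v (-1)) (v 0) hne hf1 hf0
  have Φinj : Function.Injective Φ := Φ.injective
  have hfrI : frontier (Φ '' P) = Φ '' frontier P := (Φ.toHomeomorph.image_frontier P).symm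
  have hintI : interior (Φ '' P) = Φ '' interior P := (Φ.toHomeomorph.image_interior P).symm
  have hclI : ∀ S, closure (Φ '' S) = Φ '' closure S := fun S => (Φ.toHomeomorph.image_closure S).symm
  have hvis : ∀ x y, WV.Vis (Φ '' P) (Φ x) (Φ y) ↔ segment ℝ x y ⊆ P := by
    intro x y
    unfold WV.Vis
    rw [WV.seg_img, Set.image_subset_image_iff Φinj]
  have Q : WV.Poly (Φ '' P) (fun i => Φ (v i)) :=
    { hn := hn
      inj := Φinj.comp hinj
      fr := by
        rw [hfrI, hfr, Set.image_iUnion]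
        simp only [WV.seg_img]
      adj := by
        intro i
        simp only [WV.seg_img]
        rw [← Set.image_inter Φinj, hadj i, Set.image_singleton]
      dis := by
        intro i j h1 h2 h3
        simp only [WV.seg_img]
        exact (Set.disjoint_image_iff Φinj).2 (hdis i j h1 h2 h3) }
  have hedge : segment ℝ (v (-1)) (v 0) ⊆ frontier P := by
    rw [hfr]
    have := Set.subset_iUnion (fun i : Fin n => segment ℝ (v i) (v (i + 1))) (-1)
    simpa using this
  have K : WV.Core (Φ '' P) (Set.range (fun i => Φ (v i))) a b :=
    { huw := hab
      cpt := hcpt.image Φ.continuous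
      reg := by rw [hintI, hclI, ← hreg]
      conn := Q.conn
      loc := fun x hx => Q.loc hx
      half := by
        rintro _ ⟨p, hp, rfl⟩
        rw [hΦ2]; linarith [hfP p hp]
      edge := by
        rw [← hΦa, ← hΦb, WV.seg_img, hfrI]
        exact Set.image_mono hedge
      uN := ⟨-1, hΦa⟩
      wv := by
        rintro _ ⟨p, hp, rfl⟩
        obtain ⟨q, hq, hqp⟩ := hwv p hp
        have h1 : Φ q ∈ segment ℝ ((a, 0) : ℝ × ℝ) (b, 0) := by
          rw [← hΦa, ← hΦb, WV.seg_img]; exact ⟨q, hq, rfl⟩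
        obtain ⟨t, t0, t1, e1, e2⟩ := WV.mem_seg.1 h1
        simp only [sub_self, mul_zero, add_zero] at e1 e2
        refine ⟨(Φ q).1, ?_, ?_, ?_⟩
        · rw [e1]; nlinarith
        · rw [e1]; nlinarith
        · have : (((Φ q).1, 0) : ℝ × ℝ) = Φ q := Prod.ext rfl e2.symm
          rw [this]
          exact (hvis q p).2 hqp }
  obtain ⟨G', hG1, hG2, hG3⟩ := WV.core_main K (Set.finite_range _) (G.image Φ) (by
    rw [hfrI]
    rintro _ ⟨x, hx, rfl⟩
    obtain ⟨g, hg, hgx⟩ := hG_guards x hx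
    exact ⟨Φ g, Finset.mem_image_of_mem _ hg, (hvis g x).2 hgx⟩)
  refine ⟨G'.image Φ.symm, ?_, ?_, ?_⟩
  · intro z hz
    obtain ⟨y, hy, rfl⟩ := Finset.mem_image.1 (Finset.mem_coe.1 hz)
    obtain ⟨i, hi⟩ := hG1 (Finset.mem_coe.2 hy)
    refine ⟨i, ?_⟩
    rw [← hi]; simp
  · exact Finset.card_image_le.trans (hG2.trans Finset.card_image_le)
  · intro p hp
    obtain ⟨g, hg, hgp⟩ := hG3 (Φ p) ⟨p, hp, rfl⟩
    rcases hg with hg | hg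
    · obtain ⟨g0, hg0, rfl⟩ := Finset.mem_image.1 hg
      exact ⟨g0, Or.inl hg0, (hvis g0 p).1 hgp⟩
    · refine ⟨Φ.symm g, Or.inr (Finset.mem_coe.2 (Finset.mem_image_of_mem _ hg)), ?_⟩
      rw [← hvis]
      simpa using hgp
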